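/- For every $y \in \mathbb{C}$ and every $z \in \mathbb{C}^n$ such that $\psi([m'_{v,i}])\, e^{\langle m'_{v,i}, z\rangle} \ne 1$ for all vertices $v$, all $i$, and all characters $\psi$ of $M'_v/\mathbb{Z}^n$, the following weighted Brion formula holds (both sides being finite sums of complex numbers): $\sum_{E \preceq P} (1+y)^{\dim E} \sum_{m \in \mathrm{Relint}(E) \cap \mathbb{Z}^n} e^{\langle m, z\rangle} \;=\; \sum_{v \text{ vertex of } P} \frac{e^{\langle v, z\rangle}}{d_v} \sum_{\psi : M'_v/\mathbb{Z}^n \to \mathbb{C}^\times} \prod_{i=1}^n \frac{1 + y\,\psi([m'_{v,i}])\, e^{\langle m'_{v,i}, z\rangle}}{1 - \psi([m'_{v,i}])\, e^{\langle m'_{v,i}, z\rangle}}$. For $y = 0$ this is Brion's formula for the lattice points of $P$. -/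

import Mathlib

open Classical

noncomputable section

/-- Cast a lattice vector to a real vector. -/
def castZ {n : ℕ} (x : Fin n → ℤ) : Fin n → ℝ := fun i => (x i : ℝ)

/-- The standard `ℂ`-bilinear pairing between `ℤ^n` and `ℂ^n`. -/
def pairCZ {n : ℕ} (x : Fin n → ℤ) (z : Fin n → ℂ) : ℂ := ∑ j, (x j : ℂ) * z j

/-- The standard `ℂ`-bilinear pairing between `ℚ^n` and `ℂ^n`. -/
def pairCQ {n : ℕ} (x : Fin n → ℚ) (z : Fin n → ℂ) : ℂ := ∑ j, (x j : ℂ) * z j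

/-- The tangent cone at `v` cut out by the inward normals `uv j`:
`{m : ⟨m - v, uvⱼ⟩ ≥ 0 for all j}`. -/
def tanConeN {n : ℕ} (v : Fin n → ℝ) (uv : Fin n → Fin n → ℤ) : Set (Fin n → ℝ) :=
  {x | ∀ j, 0 ≤ ∑ i, (x i - v i) * (uv j i : ℝ)}

/-- The integers, as a `ℤ`-submodule of `ℚ`. -/
def intQ : Submodule ℤ ℚ := Submodule.span ℤ {1}

/-- The pairing with the lattice vector `u`, as a `ℤ`-linear form on `ℚ^n`. -/
def pairingU {n : ℕ} (u : Fin n → ℤ) : (Fin n → ℚ) →ₗ[ℤ] ℚ :=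
  ((∑ k, (u k : ℚ) • LinearMap.proj k : (Fin n → ℚ) →ₗ[ℚ] ℚ)).restrictScalars ℤ

/-- The dual lattice `M'_v = {m ∈ ℚ^n : ⟨m, u_{v,j}⟩ ∈ ℤ for all j}`. -/
def Mv {n : ℕ} (uv : Fin n → Fin n → ℤ) : Submodule ℤ (Fin n → ℚ) :=
  ⨅ j, intQ.comap (pairingU (uv j))

/-- The integer lattice `ℤ^n`, as a `ℤ`-submodule of `ℚ^n`. -/
def intLatQ (n : ℕ) : Submodule ℤ (Fin n → ℚ) :=
  ⨅ i, intQ.comap ((LinearMap.proj (R := ℚ) i).restrictScalars ℤ)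

/-- The integer lattice `ℤ^n`, viewed inside `M'_v`. -/
def latIn {n : ℕ} (uv : Fin n → Fin n → ℤ) : Submodule ℤ (Mv uv) :=
  (intLatQ n).comap (Mv uv).subtype

/-- The finite abelian group `M'_v / ℤ^n`. -/
abbrev Qv {n : ℕ} (uv : Fin n → Fin n → ℤ) := Mv uv ⧸ latIn uv

/-- The class `[m']` of `m' ∈ M'_v` in `M'_v / ℤ^n` (defined to be `0` if `m' ∉ M'_v`). -/
def clsOf {n : ℕ} (uv : Fin n → Fin n → ℤ) (m : Fin n → ℚ) : Qv uv :=
  if h : m ∈ Mv uv then Submodule.Quotient.mk (⟨m, h⟩ : Mv uv) else 0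

/-- A face of the polytope `P`: a nonempty convex extreme subset (this includes `P` itself
and the vertices). -/
def IsFaceOf {n : ℕ} (P E : Set (Fin n → ℝ)) : Prop :=
  E.Nonempty ∧ Convex ℝ E ∧ IsExtreme ℝ P E

/-! ### Functions on a group as a module over its group algebra -/

/-- The translation representation of a group on the complex functions on it. -/
def translation (G : Type*) [AddCommGroup G] : Multiplicative G →* Module.End ℂ (G → ℂ) where
  toFun g :=
    { toFun := fun φ x => φ (x - g.toAdd)
      map_add' := fun _ _ => rfl
      map_smul' := fun _ _ => rfl }
  map_one' := by ext φ x; simp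
  map_mul' g h := by
    refine LinearMap.ext fun φ => funext fun x => ?_
    change φ (x - (g * h).toAdd) = φ (x - g.toAdd - h.toAdd)
    rw [toAdd_mul, sub_sub]

/-- The action of the group algebra on functions by translation operators. -/
def act {G : Type*} [AddCommGroup G] : AddMonoidAlgebra ℂ G →ₐ[ℂ] Module.End ℂ (G → ℂ) :=
  AddMonoidAlgebra.lift ℂ _ G (translation G)

section GroupAlgebra

variable {G : Type*} [AddCommGroup G]

open AddMonoidAlgebra

lemma act_single (g : G) (c : ℂ) (φ : G → ℂ) (x : G) :
    act (single g c) φ x = c * φ (x - g) := by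
  rw [act, lift_single]
  rfl

lemma act_mul (a b : AddMonoidAlgebra ℂ G) (φ : G → ℂ) : act (a * b) φ = act a (act b φ) := by
  rw [map_mul]; rfl

lemma act_coeff (a b : AddMonoidAlgebra ℂ G) :
    act a (b.coeff : G → ℂ) = ((a * b).coeff : G → ℂ) := by
  induction a using AddMonoidAlgebra.induction_linear with
  | zero => simp
  | add f g hf hg =>
    rw [map_add, add_mul, LinearMap.add_apply, hf, hg]; rfl
  | single g c =>
    funext x
    rw [act_single, coeff_single_mul_apply, neg_add_eq_sub]

lemma act_one_add_single (g : G) (c : ℂ) (φ : G → ℂ) (x : G) :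
    act (1 + single g c) φ x = φ x + c * φ (x - g) := by
  rw [map_add, map_one, LinearMap.add_apply, Pi.add_apply, act_single]; rfl

lemma one_sub_single (g : G) (c : ℂ) :
    (1 - single g c : AddMonoidAlgebra ℂ G) = 1 + single g (-c) := by
  rw [single_neg, sub_eq_add_neg]

lemma act_one_sub_single (g : G) (φ : G → ℂ) (x : G) :
    act (1 - single g 1) φ x = φ x - φ (x - g) := by
  rw [one_sub_single, act_one_add_single]; ring

/-- `φ` becomes a finitely supported function after multiplication by an element of the group
algebra on which `ev` does not vanish, and the resulting fraction evaluates to `c` at `ev`. -/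
def HasValue (ev : AddMonoidAlgebra ℂ G →ₐ[ℂ] ℂ) (φ : G → ℂ) (c : ℂ) : Prop :=
  ∃ a b : AddMonoidAlgebra ℂ G, ev a ≠ 0 ∧ act a φ = b.coeff ∧ ev b = c * ev a

variable {ev : AddMonoidAlgebra ℂ G →ₐ[ℂ] ℂ}

lemma HasValue.zero : HasValue ev (0 : G → ℂ) 0 :=
  ⟨1, 0, by simp, by simp, by simp⟩

lemma HasValue.add {φ φ' : G → ℂ} {c c' : ℂ} (h : HasValue ev φ c) (h' : HasValue ev φ' c') :
    HasValue ev (φ + φ') (c + c') := by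
  obtain ⟨a, b, ha, hb, hc⟩ := h
  obtain ⟨a', b', ha', hb', hc'⟩ := h'
  refine ⟨a * a', a' * b + a * b', by simp [ha, ha'], ?_, ?_⟩
  · rw [map_add, act_mul a a' φ', hb', act_coeff, mul_comm a a', act_mul, hb, act_coeff]; rfl
  · simp only [map_add, map_mul, hc, hc']; ring

lemma HasValue.smul {φ : G → ℂ} {c : ℂ} (h : HasValue ev φ c) (r : ℂ) :
    HasValue ev (r • φ) (r * c) := by
  obtain ⟨a, b, ha, hb, hc⟩ := h
  refine ⟨a, r • b, ha, ?_, ?_⟩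
  · rw [map_smul, hb]; rfl
  · simp [hc, mul_assoc]

lemma HasValue.sum {κ : Type*} {s : Finset κ} {φ : κ → G → ℂ} {c : κ → ℂ}
    (h : ∀ k ∈ s, HasValue ev (φ k) (c k)) : HasValue ev (∑ k ∈ s, φ k) (∑ k ∈ s, c k) := by
  induction s using Finset.induction_on with
  | empty => simpa using HasValue.zero
  | insert k s hk ih =>
    rw [Finset.sum_insert hk, Finset.sum_insert hk]
    exact (h k (by simp)).add (ih fun j hj => h j (by simp [hj]))

/-- A finitely supported function which differs from `φ` by a torsion function evaluates to the
value of `φ`. -/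
lemma HasValue.eval_eq [NoZeroDivisors (AddMonoidAlgebra ℂ G)] {φ : G → ℂ} {c : ℂ}
    (h : HasValue ev φ c) {f D : AddMonoidAlgebra ℂ G} (hD : D ≠ 0)
    (htors : act D ((f.coeff : G → ℂ) - φ) = 0) : ev f = c := by
  obtain ⟨a, b, ha, hb, hc⟩ := h
  have key : D * (a * f - b) = 0 := by
    have h1 : act (a * D) ((f.coeff : G → ℂ) - φ) = 0 := by rw [act_mul, htors, map_zero]
    rw [mul_comm, act_mul, map_sub, hb, act_coeff] at h1
    have h2 : ((a * f).coeff : G → ℂ) - b.coeff = ((a * f - b).coeff : G → ℂ) := rfl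
    rw [h2, act_coeff] at h1
    ext x
    exact congrFun h1 x
  have h3 : a * f = b := sub_eq_zero.1 ((mul_eq_zero.1 key).resolve_left hD)
  have h4 : ev a * ev f = c * ev a := by rw [← map_mul, h3, hc]
  rw [mul_comm] at h4
  exact mul_right_cancel₀ ha h4

lemma one_sub_single_ne_zero {g : G} (hg : g ≠ 0) :
    (1 - single g 1 : AddMonoidAlgebra ℂ G) ≠ 0 := by
  intro h
  have h1 : (1 - single g 1 : AddMonoidAlgebra ℂ G).coeff 0 = 0 := by rw [h]; rfl
  rw [one_def, coeff_sub, Finsupp.sub_apply, coeff_single, coeff_single,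
    Finsupp.single_eq_same, Finsupp.single_eq_of_ne hg.symm] at h1
  simp at h1

lemma one_sub_single_dvd (g : G) (k : ℕ) :
    (1 - single g 1 : AddMonoidAlgebra ℂ G) ∣ 1 - single (k • g) 1 := by
  have := sub_dvd_pow_sub_pow (1 : AddMonoidAlgebra ℂ G) (single g 1) k
  rwa [one_pow, single_pow, one_pow] at this

/-- Operators supported on a subgroup commute with restriction to that subgroup. -/
lemma act_prod_indicator {Z : AddSubgroup G} {κ : Type*} (s : Finset κ) (g : κ → G)
    (hg : ∀ k ∈ s, g k ∈ Z) (φ : G → ℂ) :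
    act (∏ k ∈ s, (1 - single (g k) 1)) ((Z : Set G).indicator φ) =
      (Z : Set G).indicator (act (∏ k ∈ s, (1 - single (g k) 1)) φ) := by
  induction s using Finset.induction_on with
  | empty => simp
  | insert k s hk ih =>
    rw [Finset.prod_insert hk, act_mul, act_mul, ih fun j hj => hg j (by simp [hj])]
    funext x
    have hkZ := hg k (by simp)
    have hx : x - g k ∈ Z ↔ x ∈ Z :=
      ⟨fun h => by simpa using Z.add_mem h hkZ, fun h => Z.sub_mem h hkZ⟩
    simp only [act_one_sub_single, Set.indicator_apply, SetLike.mem_coe, hx]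
    split_ifs <;> simp

/-- Acting by a `k`-fold product of difference operators only involves nearby values. -/
lemma act_prod_eq_zero_of_ball {E : Type*} [NormedAddCommGroup E] {κ : Type*} (s : Finset κ)
    (g : κ → E) (φ : E → ℂ) (x : E) (h : ∀ x', ‖x' - x‖ ≤ ∑ k ∈ s, ‖g k‖ → φ x' = 0) :
    act (∏ k ∈ s, (1 - single (g k) 1)) φ x = 0 := by
  induction s using Finset.induction_on generalizing x with
  | empty => simpa using h x (by simp)
  | insert k s hk ih =>
    rw [Finset.prod_insert hk, act_mul, act_one_sub_single, ih, ih, sub_zero]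
    · intro x' hx'
      apply h
      rw [Finset.sum_insert hk]
      have : x' - x = (x' - (x - g k)) - g k := by abel
      rw [this]
      linarith [norm_sub_le (x' - (x - g k)) (g k)]
    · intro x' hx'
      apply h
      rw [Finset.sum_insert hk]
      linarith [norm_nonneg (g k)]

end GroupAlgebra

/-! ### Product functions in the coordinates of a simplicial cone -/

section ProductFunctions

variable {G κ : Type*} [AddCommGroup G] [Fintype κ] [DecidableEq κ]

open AddMonoidAlgebra

lemma act_one_add_single_prod {m : κ → G} {a : κ → G → ℝ} {s : ℝ} {χ : G → ℂ} {r : κ → ℂ}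
    (ha : ∀ i j x, a j (x - m i) = a j x - if i = j then s else 0)
    (hχ : ∀ i x, χ x = r i * χ (x - m i)) (c : ℂ) (w : κ → ℝ → ℂ) (i : κ) :
    act (1 + single (m i) (c * r i)) (fun x => χ x * ∏ j, w j (a j x)) =
      fun x => χ x * ∏ j, Function.update w i (fun t => w i t + c * w i (t - s)) j (a j x) := by
  funext x
  rw [act_one_add_single]
  rw [← Finset.mul_prod_erase _ _ (Finset.mem_univ i),
    ← Finset.mul_prod_erase _ _ (Finset.mem_univ i), ← Finset.mul_prod_erase _ _ (Finset.mem_univ i)]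
  have h1 : ∏ j ∈ Finset.univ.erase i, w j (a j (x - m i)) =
      ∏ j ∈ Finset.univ.erase i, w j (a j x) :=
    Finset.prod_congr rfl fun j hj => by
      rw [ha, if_neg (Finset.ne_of_mem_erase hj).symm, sub_zero]
  have h2 : ∏ j ∈ Finset.univ.erase i,
      Function.update w i (fun t => w i t + c * w i (t - s)) j (a j x) =
      ∏ j ∈ Finset.univ.erase i, w j (a j x) :=
    Finset.prod_congr rfl fun j hj => by
      rw [Function.update_of_ne (Finset.ne_of_mem_erase hj)]
  rw [h1, h2, Function.update_self, ha, if_pos rfl]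
  have h3 : c * r i * (χ (x - m i) * (w i (a i x - s) * ∏ j ∈ Finset.univ.erase i, w j (a j x))) =
      (r i * χ (x - m i)) * (c * w i (a i x - s) * ∏ j ∈ Finset.univ.erase i, w j (a j x)) := by
    ring
  rw [h3, ← hχ]
  ring

lemma act_prod_one_add_single {m : κ → G} {a : κ → G → ℝ} {s : ℝ} {χ : G → ℂ} {r : κ → ℂ}
    (ha : ∀ i j x, a j (x - m i) = a j x - if i = j then s else 0)
    (hχ : ∀ i x, χ x = r i * χ (x - m i)) (c : ℂ) (w : ℝ → ℂ) :
    act (∏ i, (1 + single (m i) (c * r i))) (fun x => χ x * ∏ j, w (a j x)) =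
      fun x => χ x * ∏ j, (w (a j x) + c * w (a j x - s)) := by
  have key : ∀ T : Finset κ,
      act (∏ i ∈ T, (1 + single (m i) (c * r i))) (fun x => χ x * ∏ j, w (a j x)) =
        fun x => χ x * ∏ j, (fun j t => if j ∈ T then w t + c * w (t - s) else w t) j (a j x) := by
    intro T
    induction T using Finset.induction_on with
    | empty => simp
    | insert i T hi ih =>
      rw [Finset.prod_insert hi, act_mul, ih]
      refine (act_one_add_single_prod ha hχ c
        (fun j t => if j ∈ T then w t + c * w (t - s) else w t) i).trans ?_
      funext x
      congr 1
      refine Finset.prod_congr rfl fun j _ => ?_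
      by_cases hj : j = i
      · subst hj; simp [hi]
      · simp [hj]
  rw [key]
  simp

end ProductFunctions

/-! ### Lattices and dual bases -/

section Lattices

variable {n : ℕ}

/-- Cast a rational vector to a real vector. -/
def castQ (x : Fin n → ℚ) : Fin n → ℝ := fun i => (x i : ℝ)

lemma castQ_injective : Function.Injective (castQ : (Fin n → ℚ) → Fin n → ℝ) := fun _ _ h =>
  funext fun i => Rat.cast_injective (congrFun h i)

lemma castZ_injective : Function.Injective (castZ : (Fin n → ℤ) → Fin n → ℝ) := fun _ _ h =>
  funext fun i => Int.cast_injective (congrFun h i)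

/-- The integer lattice in `ℝ^n`. -/
def intLatR (n : ℕ) : AddSubgroup (Fin n → ℝ) :=
  AddMonoidHom.range
    { toFun := castZ
      map_zero' := by ext; simp [castZ]
      map_add' := fun x y => by ext; simp [castZ] }

lemma mem_intLatR {x : Fin n → ℝ} : x ∈ intLatR n ↔ ∃ p : Fin n → ℤ, castZ p = x := Iff.rfl

lemma castZ_mem_intLatR (p : Fin n → ℤ) : castZ p ∈ intLatR n := ⟨p, rfl⟩

lemma mem_intQ {x : ℚ} : x ∈ intQ ↔ ∃ k : ℤ, (k : ℚ) = x := by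
  simp [intQ, Submodule.mem_span_singleton]

lemma mem_Mv {u : Fin n → Fin n → ℤ} {q : Fin n → ℚ} :
    q ∈ Mv u ↔ ∀ j, ∃ k : ℤ, (k : ℚ) = ∑ i, q i * (u j i : ℚ) := by
  simp [Mv, mem_intQ, pairingU, mul_comm]

lemma mem_intLatQ {q : Fin n → ℚ} : q ∈ intLatQ n ↔ ∃ p : Fin n → ℤ, castZ p = castQ q := by
  have h : q ∈ intLatQ n ↔ ∀ i, ∃ k : ℤ, (k : ℚ) = q i := by simp [intLatQ, mem_intQ]
  rw [h]
  constructor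
  · intro h
    choose p hp using h
    refine ⟨p, funext fun i => ?_⟩
    simp [castZ, castQ, ← hp i]
  · rintro ⟨p, hp⟩ i
    exact ⟨p i, by have := congrFun hp i; simp only [castZ, castQ] at this; exact_mod_cast this⟩

lemma exists_smul_castQ_mem (q : Fin n → ℚ) : ∃ N : ℕ, 0 < N ∧ N • castQ q ∈ intLatR n := by
  refine ⟨∏ i, (q i).den, Finset.prod_pos fun i _ => (q i).den_pos, mem_intLatR.2 ⟨
    fun i => (q i).num * ((∏ j ∈ Finset.univ.erase i, (q j).den : ℕ) : ℤ), funext fun i => ?_⟩⟩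
  have h1 : (((q i).den : ℕ) : ℝ) * (q i : ℝ) = (q i).num := by
    exact_mod_cast Rat.den_mul_eq_num (q i)
  rw [← Finset.mul_prod_erase _ _ (Finset.mem_univ i)]
  simp only [castZ, castQ, Pi.smul_apply, nsmul_eq_mul]
  push_cast
  rw [← h1]
  ring

/-- The coordinates with respect to the cone with apex `v` and normals `u`. -/
def coneCoord (v : Fin n → ℝ) (u : Fin n → Fin n → ℤ) (j : Fin n) (x : Fin n → ℝ) : ℝ :=
  ∑ i, (x i - v i) * (u j i : ℝ)

variable {u : Fin n → Fin n → ℤ} {m : Fin n → Fin n → ℚ}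

lemma dual_real (hdual : ∀ i j, ∑ k, m i k * (u j k : ℚ) = if i = j then 1 else 0) (i j : Fin n) :
    ∑ k, castQ (m i) k * (u j k : ℝ) = if i = j then 1 else 0 := by
  have := congrArg (Rat.cast : ℚ → ℝ) (hdual i j)
  push_cast at this
  exact this.trans (by split_ifs <;> simp)

lemma coneCoord_sub (hdual : ∀ i j, ∑ k, m i k * (u j k : ℚ) = if i = j then 1 else 0)
    (v : Fin n → ℝ) (s : ℝ) (i j : Fin n) (x : Fin n → ℝ) :
    coneCoord v u j (x - s • castQ (m i)) = coneCoord v u j x - if i = j then s else 0 := by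
  have h : (if i = j then s else 0) = s * ∑ k, castQ (m i) k * (u j k : ℝ) := by
    rw [dual_real hdual]; simp
  rw [h, coneCoord, coneCoord, Finset.mul_sum, ← Finset.sum_sub_distrib]
  refine Finset.sum_congr rfl fun k _ => ?_
  simp only [Pi.sub_apply, Pi.smul_apply, smul_eq_mul]
  ring

lemma sum_pairing_smul_eq (hdual : ∀ i j, ∑ k, m i k * (u j k : ℚ) = if i = j then 1 else 0)
    (d : Fin n → ℝ) : ∑ j, (∑ i, d i * (u j i : ℝ)) • castQ (m j) = d := by
  let M : Matrix (Fin n) (Fin n) ℝ := Matrix.of fun i k => castQ (m i) k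
  let U : Matrix (Fin n) (Fin n) ℝ := Matrix.of fun k j => (u j k : ℝ)
  have h : M * U = 1 := by
    ext i j
    rw [Matrix.mul_apply, Matrix.one_apply]
    exact dual_real hdual i j
  have h' : U * M = 1 := mul_eq_one_comm.1 h
  have h2 : Matrix.vecMul (Matrix.vecMul d U) M = d := by
    rw [Matrix.vecMul_vecMul, h', Matrix.vecMul_one]
  refine Eq.trans ?_ h2
  ext k
  simp [Matrix.vecMul, dotProduct, M, U]

lemma sub_eq_sum_coneCoord (hdual : ∀ i j, ∑ k, m i k * (u j k : ℚ) = if i = j then 1 else 0)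
    (v x : Fin n → ℝ) : x - v = ∑ j, coneCoord v u j x • castQ (m j) :=
  (sum_pairing_smul_eq hdual (x - v)).symm

lemma linearIndependent_castQ (hdual : ∀ i j, ∑ k, m i k * (u j k : ℚ) = if i = j then 1 else 0) :
    LinearIndependent ℝ fun i => castQ (m i) := by
  rw [Fintype.linearIndependent_iff]
  intro g hg j
  have h := congrArg (fun d : Fin n → ℝ => ∑ k, d k * (u j k : ℝ)) hg
  simp only [Finset.sum_apply, Pi.smul_apply, smul_eq_mul, Pi.zero_apply, zero_mul,
    Finset.sum_const_zero, Finset.sum_mul] at h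
  rw [Finset.sum_comm] at h
  simp only [mul_assoc, ← Finset.mul_sum, dual_real hdual] at h
  simpa using h

lemma finite_Qv (hdual : ∀ i j, ∑ k, m i k * (u j k : ℚ) = if i = j then 1 else 0) :
    Finite (Qv u) := by
  have hle : Mv u ≤ Submodule.span ℤ (Set.range m) := by
    intro q hq
    choose k hk using mem_Mv.1 hq
    have h : q = ∑ j, k j • m j := by
      apply castQ_injective
      rw [← sum_pairing_smul_eq hdual (castQ q)]
      ext i
      simp only [Finset.sum_apply, Pi.smul_apply, castQ]
      push_cast
      refine Finset.sum_congr rfl fun j _ => ?_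
      have := congrArg (Rat.cast : ℚ → ℝ) (hk j)
      push_cast at this
      rw [← this]
      simp
    rw [h]
    exact Submodule.sum_mem _ fun j _ =>
      Submodule.smul_mem _ _ (Submodule.subset_span (Set.mem_range_self j))
  have hfin : Module.Finite ℤ (Submodule.span ℤ (Set.range m)) :=
    Module.Finite.span_of_finite ℤ (Set.finite_range m)
  have hfin' : Module.Finite ℤ (Mv u) :=
    Module.Finite.iff_fg.2 (isNoetherian_submodule.1 inferInstance _ hle)
  refine Module.finite_of_fg_torsion (Qv u) fun x => ?_
  induction x using Submodule.Quotient.induction_on with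
  | H q =>
    obtain ⟨N, hN, p, hp⟩ := exists_smul_castQ_mem (q : Fin n → ℚ)
    refine ⟨⟨(N : ℤ), mem_nonZeroDivisors_of_ne_zero (by exact_mod_cast hN.ne')⟩, ?_⟩
    change (N : ℤ) • (Submodule.Quotient.mk q : Qv u) = 0
    rw [← Submodule.Quotient.mk_smul, Submodule.Quotient.mk_eq_zero]
    refine mem_intLatQ.2 ⟨p, hp.trans ?_⟩
    ext i
    simp [castQ]

/-- Characters with values in units are the same as complex characters. -/
def addCharUnitsEquiv (Q : Type*) [AddCommGroup Q] : AddChar Q ℂˣ ≃ AddChar Q ℂ where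
  toFun ψ := (Units.coeHom ℂ).compAddChar ψ
  invFun ψ :=
    { toFun := fun q => (ψ.val_isUnit q).unit
      map_zero_eq_one' := Units.ext (by simp)
      map_add_eq_mul' := fun a b => Units.ext (by simp [AddChar.map_add_eq_mul]) }
  left_inv ψ := by ext; simp
  right_inv ψ := by ext; simp

lemma sum_addChar_units {Q : Type*} [AddCommGroup Q] [Finite Q] [Fintype (AddChar Q ℂˣ)] (q : Q) :
    ∑ ψ : AddChar Q ℂˣ, (ψ q : ℂ) = if q = 0 then (Nat.card Q : ℂ) else 0 := by
  have := Fintype.ofFinite Q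
  rw [Nat.card_eq_fintype_card, ← AddChar.sum_apply_eq_ite q]
  exact Fintype.sum_equiv (addCharUnitsEquiv Q) _ _ fun ψ => rfl

end Lattices

/-! ### The weighted generating function of a simplicial cone -/

section Cones

variable {n : ℕ}

open AddMonoidAlgebra

/-- The weight of a half-line. -/
def rayWeight (y : ℂ) (t : ℝ) : ℂ := if t < 0 then 0 else if t = 0 then 1 else 1 + y

/-- The weight function of the cone with apex `v` and normals `u`. -/
def coneWeight (y : ℂ) (v : Fin n → ℝ) (u : Fin n → Fin n → ℤ) (x : Fin n → ℝ) : ℂ :=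
  ∏ j, rayWeight y (coneCoord v u j x)

variable {u : Fin n → Fin n → ℤ} {m : Fin n → Fin n → ℚ}

lemma rayWeight_sub_eq_zero (y : ℂ) {t s : ℝ} (hs : 0 ≤ s) (ht : ¬(0 ≤ t ∧ t ≤ s)) :
    rayWeight y t - rayWeight y (t - s) = 0 := by
  rw [not_and_or, not_le, not_le] at ht
  rcases ht with ht | ht
  · rw [rayWeight, rayWeight, if_pos ht, if_pos (by linarith), sub_zero]
  · rw [rayWeight, rayWeight, if_neg (by linarith), if_neg (by linarith), if_neg (by linarith),
      if_neg (by linarith), sub_self]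

lemma act_prod_coneWeight_eq_zero
    (hdual : ∀ i j, ∑ k, m i k * (u j k : ℚ) = if i = j then 1 else 0) (y : ℂ) (v : Fin n → ℝ)
    {s : ℝ} (hs : 0 ≤ s) {x : Fin n → ℝ} (hx : s * ∑ i, ‖castQ (m i)‖ < ‖x - v‖) :
    act (∏ i, (1 - single (s • castQ (m i)) 1)) (coneWeight y v u) x = 0 := by
  have h := act_prod_one_add_single (m := fun i => s • castQ (m i)) (a := coneCoord v u) (s := s)
    (χ := fun _ => 1) (r := fun _ => 1) (fun i j x => coneCoord_sub hdual v s i j x)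
    (fun _ _ => by simp) (-1) (rayWeight y)
  have h1 : (fun x => 1 * ∏ j, rayWeight y (coneCoord v u j x)) = coneWeight y v u := by
    funext x; simp [coneWeight]
  simp only [h1, mul_one, ← one_sub_single] at h
  rw [h]
  beta_reduce
  by_contra hne
  have h2 : ∀ j, 0 ≤ coneCoord v u j x ∧ coneCoord v u j x ≤ s := by
    intro j
    by_contra hj
    apply hne
    have := rayWeight_sub_eq_zero y hs hj
    rw [Finset.prod_eq_zero (Finset.mem_univ j), mul_zero]
    rw [← this]; ring
  have h3 : ‖x - v‖ ≤ s * ∑ i, ‖castQ (m i)‖ := by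
    rw [sub_eq_sum_coneCoord hdual v x, Finset.mul_sum]
    refine (norm_sum_le _ _).trans (Finset.sum_le_sum fun j _ => ?_)
    rw [norm_smul, Real.norm_eq_abs, abs_of_nonneg (h2 j).1]
    exact mul_le_mul_of_nonneg_right (h2 j).2 (norm_nonneg _)
  linarith

/-- Evaluation of exponential polynomials at `z`. -/
def expEval (z : Fin n → ℂ) : AddMonoidAlgebra ℂ (Fin n → ℝ) →ₐ[ℂ] ℂ :=
  AddMonoidAlgebra.lift ℂ ℂ (Fin n → ℝ)
    { toFun := fun x => Complex.exp (∑ j, (x.toAdd j : ℂ) * z j)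
      map_one' := by simp
      map_mul' := fun a b => by
        simp [add_mul, Finset.sum_add_distrib, Complex.exp_add] }

lemma expEval_single (z : Fin n → ℂ) (x : Fin n → ℝ) (c : ℂ) :
    expEval z (single x c) = c * Complex.exp (∑ j, (x j : ℂ) * z j) := by
  rw [expEval, lift_single]; rfl

lemma expEval_castZ (z : Fin n → ℂ) (x : Fin n → ℤ) (c : ℂ) :
    expEval z (single (castZ x) c) = c * Complex.exp (pairCZ x z) := by
  rw [expEval_single]; simp [castZ, pairCZ]

lemma expEval_castQ (z : Fin n → ℂ) (x : Fin n → ℚ) (c : ℂ) :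
    expEval z (single (castQ x) c) = c * Complex.exp (pairCQ x z) := by
  rw [expEval_single]; simp [castQ, pairCQ]

/-- A character of `M'_v / ℤ^n`, viewed as a function on `ℝ^n` supported on `v + M'_v`. -/
def charFun (v : Fin n → ℝ) (u : Fin n → Fin n → ℤ) (ψ : AddChar (Qv u) ℂˣ) (x : Fin n → ℝ) : ℂ :=
  if h : ∃ q : Mv u, v + castQ (q : Fin n → ℚ) = x then
    (ψ (Submodule.Quotient.mk h.choose) : ℂ) else 0

lemma charFun_add (v : Fin n → ℝ) (ψ : AddChar (Qv u) ℂˣ) (q : Mv u) :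
    charFun v u ψ (v + castQ (q : Fin n → ℚ)) = ψ (Submodule.Quotient.mk q) := by
  have h : ∃ q' : Mv u, v + castQ (q' : Fin n → ℚ) = v + castQ (q : Fin n → ℚ) := ⟨q, rfl⟩
  rw [charFun, dif_pos h]
  have : h.choose = q := Subtype.ext (castQ_injective (add_left_cancel h.choose_spec))
  rw [this]

lemma charFun_of_not_exists {v : Fin n → ℝ} {x : Fin n → ℝ}
    (h : ¬∃ q : Mv u, v + castQ (q : Fin n → ℚ) = x) (ψ : AddChar (Qv u) ℂˣ) :
    charFun v u ψ x = 0 := dif_neg h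

lemma castQ_add (p q : Fin n → ℚ) : castQ (p + q) = castQ p + castQ q := by
  ext; simp [castQ]

lemma castQ_sub (p q : Fin n → ℚ) : castQ (p - q) = castQ p - castQ q := by
  ext; simp [castQ]

lemma charFun_shift (v : Fin n → ℝ) (ψ : AddChar (Qv u) ℂˣ) (q : Mv u) (x : Fin n → ℝ) :
    charFun v u ψ x =
      ψ (Submodule.Quotient.mk q) * charFun v u ψ (x - castQ (q : Fin n → ℚ)) := by
  by_cases h : ∃ p : Mv u, v + castQ (p : Fin n → ℚ) = x
  · obtain ⟨p, rfl⟩ := h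
    have h1 : v + castQ (p : Fin n → ℚ) - castQ (q : Fin n → ℚ) =
        v + castQ ((p - q : Mv u) : Fin n → ℚ) := by
      rw [Submodule.coe_sub, castQ_sub, add_sub_assoc]
    rw [h1, charFun_add, charFun_add, ← Units.val_mul, ← AddChar.map_add_eq_mul,
      ← Submodule.Quotient.mk_add, add_sub_cancel]
  · rw [charFun_of_not_exists h, charFun_of_not_exists, mul_zero]
    rintro ⟨p, hp⟩
    refine h ⟨p + q, ?_⟩
    rw [Submodule.coe_add, castQ_add, ← add_assoc, hp, sub_add_cancel]

lemma coneCoord_of_mem_Mv (v : Fin n → ℝ) (q : Mv u) (j : Fin n) :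
    ∃ k : ℤ, coneCoord v u j (v + castQ (q : Fin n → ℚ)) = k := by
  obtain ⟨k, hk⟩ := mem_Mv.1 q.2 j
  refine ⟨k, ?_⟩
  have := congrArg (Rat.cast : ℚ → ℝ) hk
  push_cast at this
  rw [this]
  simp [coneCoord, castQ]

lemma rayWeight_int (y : ℂ) (k : ℤ) :
    rayWeight y k + -1 * rayWeight y (k - 1) =
      (if (k : ℝ) = 0 then 1 else 0) + y * (if (k : ℝ) - 1 = 0 then 1 else 0) := by
  have h0 : (k : ℝ) < 0 ↔ k < 0 := by norm_cast
  have h1 : (k : ℝ) = 0 ↔ k = 0 := by norm_cast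
  have h2 : (k : ℝ) - 1 < 0 ↔ k - 1 < 0 := by norm_cast
  have h3 : (k : ℝ) - 1 = 0 ↔ k - 1 = 0 := by norm_cast
  simp only [rayWeight, h0, h1, h2, h3]
  split_ifs <;> first | omega | ring

lemma hasValue_charFun_mul_coneWeight
    (hdual : ∀ i j, ∑ k, m i k * (u j k : ℚ) = if i = j then 1 else 0)
    (hmem : ∀ i, m i ∈ Mv u) (v : Fin n → ℤ) (y : ℂ) (z : Fin n → ℂ) (ψ : AddChar (Qv u) ℂˣ)
    (hz : ∀ i, (ψ (clsOf u (m i)) : ℂ) * Complex.exp (pairCQ (m i) z) ≠ 1) :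
    HasValue (expEval z) (fun x => charFun (castZ v) u ψ x * coneWeight y (castZ v) u x)
      (Complex.exp (pairCZ v z) *
        ∏ i, (1 + y * (ψ (clsOf u (m i)) : ℂ) * Complex.exp (pairCQ (m i) z)) /
          (1 - (ψ (clsOf u (m i)) : ℂ) * Complex.exp (pairCQ (m i) z))) := by
  have hcls : ∀ i, clsOf u (m i) = Submodule.Quotient.mk (⟨m i, hmem i⟩ : Mv u) :=
    fun i => dif_pos (hmem i)
  have hcoord : ∀ i j x, coneCoord (castZ v) u j (x - castQ (m i)) =
      coneCoord (castZ v) u j x - if i = j then 1 else 0 := fun i j x => by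
    have := coneCoord_sub hdual (castZ v) 1 i j x
    rwa [one_smul] at this
  have hχ : ∀ i x, charFun (castZ v) u ψ x =
      ψ (clsOf u (m i)) * charFun (castZ v) u ψ (x - castQ (m i)) := fun i x => by
    rw [hcls]; exact charFun_shift (castZ v) ψ ⟨m i, hmem i⟩ x
  have hnum : act (∏ i, (1 + single (castQ (m i)) (-1 * (ψ (clsOf u (m i)) : ℂ))))
      (fun x => charFun (castZ v) u ψ x * coneWeight y (castZ v) u x) =
      ((∏ i, (1 + single (castQ (m i)) (y * (ψ (clsOf u (m i)) : ℂ)))) *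
        single (castZ v) 1).coeff := by
    rw [← act_coeff]
    have hapex : ((single (castZ v) 1 : AddMonoidAlgebra ℂ (Fin n → ℝ)).coeff : (Fin n → ℝ) → ℂ) =
        fun x => charFun (castZ v) u ψ x *
          ∏ j, (if coneCoord (castZ v) u j x = 0 then 1 else 0) := by
      funext x
      rw [coeff_single]
      by_cases hx : x = castZ v
      · subst hx
        have h0 : (castZ v : Fin n → ℝ) = castZ v + castQ ((0 : Mv u) : Fin n → ℚ) := by
          ext; simp [castQ]
        have h1 : charFun (castZ v) u ψ (castZ v) = 1 := by
          have := charFun_add (castZ v) ψ 0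
          rw [← h0] at this
          rw [this, Submodule.Quotient.mk_zero, AddChar.map_zero_eq_one, Units.val_one]
        rw [h1, Finsupp.single_eq_same, Finset.prod_eq_one, mul_one]
        intro j _
        rw [if_pos]
        simp [coneCoord]
      · rw [Finsupp.single_eq_of_ne hx]
        have : ∃ j, coneCoord (castZ v) u j x ≠ 0 := by
          by_contra! h
          apply hx
          have := sub_eq_sum_coneCoord hdual (castZ v) x
          simpa [h, sub_eq_zero] using this
        obtain ⟨j, hj⟩ := this
        rw [Finset.prod_eq_zero (Finset.mem_univ j) (if_neg hj), mul_zero]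
    rw [hapex, act_prod_one_add_single hcoord hχ y (fun t : ℝ => if t = 0 then (1 : ℂ) else 0)]
    refine (act_prod_one_add_single hcoord hχ (-1) (rayWeight y)).trans (funext fun x => ?_)
    by_cases h : ∃ q : Mv u, castZ v + castQ (q : Fin n → ℚ) = x
    · obtain ⟨q, rfl⟩ := h
      congr 1
      refine Finset.prod_congr rfl fun j _ => ?_
      obtain ⟨k, hk⟩ := coneCoord_of_mem_Mv (castZ v) q j
      rw [hk, rayWeight_int]
    · rw [charFun_of_not_exists h, zero_mul, zero_mul]
  have hden : ∀ i, 1 - (ψ (clsOf u (m i)) : ℂ) * Complex.exp (pairCQ (m i) z) ≠ 0 :=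
    fun i => sub_ne_zero.2 (hz i).symm
  have hden' : expEval z (∏ i, (1 + single (castQ (m i)) (-1 * (ψ (clsOf u (m i)) : ℂ)))) =
      ∏ i, (1 - (ψ (clsOf u (m i)) : ℂ) * Complex.exp (pairCQ (m i) z)) := by
    rw [map_prod]
    refine Finset.prod_congr rfl fun i _ => ?_
    rw [map_add, map_one, expEval_castQ]; ring
  refine ⟨_, _, ?_, hnum, ?_⟩
  · rw [hden']
    exact Finset.prod_ne_zero_iff.2 fun i _ => hden i
  · rw [hden', map_mul, map_prod, expEval_castZ, mul_assoc, ← Finset.prod_mul_distrib, one_mul,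
      mul_comm]
    congr 1
    refine Finset.prod_congr rfl fun i _ => ?_
    rw [map_add, map_one, expEval_castQ, div_mul_cancel₀ _ (hden i)]

lemma sum_charFun [Finite (Qv u)] [Fintype (AddChar (Qv u) ℂˣ)] (v : Fin n → ℤ) (x : Fin n → ℝ) :
    ∑ ψ : AddChar (Qv u) ℂˣ, charFun (castZ v) u ψ x =
      if x ∈ intLatR n then (Nat.card (Qv u) : ℂ) else 0 := by
  by_cases h : ∃ q : Mv u, castZ v + castQ (q : Fin n → ℚ) = x
  · obtain ⟨q, rfl⟩ := h
    simp only [charFun_add]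
    rw [sum_addChar_units]
    refine if_congr ?_ rfl rfl
    rw [Submodule.Quotient.mk_eq_zero]
    refine Iff.trans mem_intLatQ ?_
    rw [(intLatR n).add_mem_cancel_left (castZ_mem_intLatR v)]
    rfl
  · rw [Finset.sum_eq_zero fun ψ _ => charFun_of_not_exists h ψ, if_neg]
    rintro hx
    obtain ⟨p, hp⟩ := mem_intLatR.1 ((intLatR n).sub_mem hx (castZ_mem_intLatR v))
    refine h ⟨⟨fun i => (p i : ℚ), mem_Mv.2 fun j => ⟨∑ i, p i * u j i, by push_cast; rfl⟩⟩, ?_⟩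
    have : castQ (fun i => (p i : ℚ)) = castZ p := by ext; simp [castQ, castZ]
    rw [this, hp, add_sub_cancel]

/-- The weighted generating function of the lattice points of a simplicial cone. -/
lemma hasValue_indicator_coneWeight
    (hdual : ∀ i j, ∑ k, m i k * (u j k : ℚ) = if i = j then 1 else 0)
    (hmem : ∀ i, m i ∈ Mv u) (v : Fin n → ℤ) (y : ℂ) (z : Fin n → ℂ)
    (hz : ∀ i (ψ : AddChar (Qv u) ℂˣ),
      (ψ (clsOf u (m i)) : ℂ) * Complex.exp (pairCQ (m i) z) ≠ 1) :
    HasValue (expEval z) ((intLatR n : Set (Fin n → ℝ)).indicator (coneWeight y (castZ v) u))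
      (Complex.exp (pairCZ v z) / (Nat.card (Qv u) : ℂ) * ∑ᶠ ψ : AddChar (Qv u) ℂˣ,
        ∏ i, (1 + y * (ψ (clsOf u (m i)) : ℂ) * Complex.exp (pairCQ (m i) z)) /
          (1 - (ψ (clsOf u (m i)) : ℂ) * Complex.exp (pairCQ (m i) z))) := by
  have hfin := finite_Qv hdual
  have : Finite (AddChar (Qv u) ℂˣ) := Finite.of_equiv _ (addCharUnitsEquiv (Qv u)).symm
  have := Fintype.ofFinite (AddChar (Qv u) ℂˣ)
  have h := (HasValue.sum (s := Finset.univ) fun ψ _ =>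
    hasValue_charFun_mul_coneWeight hdual hmem v y z ψ fun i => hz i ψ).smul
      (Nat.card (Qv u) : ℂ)⁻¹
  rw [finsum_eq_sum_of_fintype]
  convert h using 1
  · funext x
    simp only [Pi.smul_apply, Finset.sum_apply, smul_eq_mul, ← Finset.sum_mul, sum_charFun,
      Set.indicator_apply, SetLike.mem_coe]
    have : (Nat.card (Qv u) : ℂ) ≠ 0 := by exact_mod_cast Nat.card_pos.ne'
    split_ifs
    · rw [inv_mul_cancel_left₀ this]
    · simp
  · rw [← Finset.mul_sum]; ring

end Cones

/-! ### Local structure of convex sets -/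

section Convexity

variable {E : Type*} [NormedAddCommGroup E] [NormedSpace ℝ E]

open Filter Topology

/-- The directions in which one can move from `x` both ways while staying inside `P`. -/
def lineDirs (P : Set E) (x : E) : Set E := {d | ∀ᶠ t in 𝓝 (0 : ℝ), x + t • d ∈ P}

/-- The weight `(1 + y) ^ dim F` of a point of `P`, where `F` is the smallest face containing it. -/
def polyWeight (y : ℂ) (P : Set E) (x : E) : ℂ :=
  if x ∈ P then (1 + y) ^ Module.finrank ℝ (Submodule.span ℝ (lineDirs P x)) else 0

lemma polyWeight_congr {P Q : Set E} {x w : E} (h : ∀ᶠ z in 𝓝 x, z ∈ P ↔ z + w ∈ Q) (y : ℂ) :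
    polyWeight y P x = polyWeight y Q (x + w) := by
  have h1 : lineDirs P x = lineDirs Q (x + w) := by
    ext d
    have ht : Tendsto (fun t : ℝ => x + t • d) (𝓝 0) (𝓝 x) := by
      have : Continuous fun t : ℝ => x + t • d := by fun_prop
      simpa using this.tendsto 0
    refine eventually_congr ((ht.eventually h).mono fun t ht => ?_)
    rw [ht, add_right_comm]
  have h2 : x ∈ P ↔ x + w ∈ Q := h.self_of_nhds
  rw [polyWeight, polyWeight, h1]
  simp only [h2]

lemma mem_lineDirs {P : Set E} (hP : Convex ℝ P) {x d : E} :
    d ∈ lineDirs P x ↔ ∃ ε : ℝ, 0 < ε ∧ x + ε • d ∈ P ∧ x - ε • d ∈ P := by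
  constructor
  · intro h
    obtain ⟨ε, hε, h⟩ := Metric.eventually_nhds_iff.1 h
    refine ⟨ε / 2, by positivity, h ?_, ?_⟩
    · rw [Real.dist_eq, sub_zero, abs_of_pos (by positivity)]; linarith
    · have := @h (-(ε / 2)) (by
        rw [Real.dist_eq, sub_zero, abs_neg, abs_of_pos (by positivity)]; linarith)
      rwa [neg_smul, ← sub_eq_add_neg] at this
  · rintro ⟨ε, hε, h1, h2⟩
    refine Metric.eventually_nhds_iff.2 ⟨ε, hε, fun t ht => ?_⟩
    rw [Real.dist_eq, sub_zero, abs_lt] at ht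
    have := hP h1 h2 (a := (1 + t / ε) / 2) (b := (1 - t / ε) / 2)
      (by have : -1 ≤ t / ε := by rw [le_div_iff₀ hε]; linarith
          linarith)
      (by have : t / ε ≤ 1 := by rw [div_le_one hε]; linarith
          linarith) (by ring)
    convert this using 1
    have h3 : ((1 + t / ε) / 2 * ε - (1 - t / ε) / 2 * ε) = t := by field_simp; ring
    rw [smul_add, smul_sub, smul_smul, smul_smul]
    nth_rewrite 1 [← h3]
    module

/-- The smallest face of `P` containing `x`. -/
def minFace (P : Set E) (x : E) : Set E := {q | q ∈ P ∧ q - x ∈ lineDirs P x}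

lemma mem_minFace_self {P : Set E} {x : E} (hx : x ∈ P) : x ∈ minFace P x :=
  ⟨hx, by simp [lineDirs, hx]⟩

lemma convex_minFace {P : Set E} (hP : Convex ℝ P) (x : E) : Convex ℝ (minFace P x) := by
  rintro q ⟨hq, hq'⟩ r ⟨hr, hr'⟩ a b ha hb hab
  refine ⟨hP hq hr ha hb hab, ?_⟩
  filter_upwards [hq', hr'] with t h1 h2
  convert hP h1 h2 ha hb hab using 1
  have hx : x = (a + b) • x := by rw [hab, one_smul]
  nth_rewrite 1 2 [hx]
  module

lemma mem_minFace {P : Set E} (hP : Convex ℝ P) {x q : E} (hx : x ∈ P) :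
    q ∈ minFace P x ↔ q ∈ P ∧ ∃ ε : ℝ, 0 < ε ∧ x - ε • (q - x) ∈ P := by
  refine and_congr_right fun hq => ?_
  rw [mem_lineDirs hP]
  constructor
  · rintro ⟨ε, hε, _, h⟩
    exact ⟨ε, hε, h⟩
  · rintro ⟨ε, hε, h⟩
    have hδ : 0 < min ε 1 := lt_min hε one_pos
    refine ⟨min ε 1, hδ, hP.add_smul_sub_mem hx hq ⟨hδ.le, min_le_right _ _⟩, ?_⟩
    have h1 := hP.add_smul_sub_mem hx h (t := min ε 1 / ε)
      ⟨by positivity, (div_le_one hε).2 (min_le_left _ _)⟩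
    convert h1 using 1
    rw [sub_sub_cancel_left, smul_neg, smul_smul, div_mul_cancel₀ _ hε.ne', sub_eq_add_neg]

lemma isExtreme_minFace {P : Set E} (hP : Convex ℝ P) {x : E} (hx : x ∈ P) :
    IsExtreme ℝ P (minFace P x) := by
  refine ⟨fun q hq => hq.1, ?_⟩
  rintro q hq r hr s hs ⟨a, b, ha, hb, hab, rfl⟩
  obtain ⟨hs1, ε, hε, hs2⟩ := (mem_minFace hP hx).1 hs
  refine (mem_minFace hP hx).2 ⟨hq, ?_⟩
  have hc : 0 < 1 + ε * b := by positivity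
  refine ⟨ε * a / (1 + ε * b), by positivity, ?_⟩
  have h1 := hP hs2 hr (a := 1 / (1 + ε * b)) (b := ε * b / (1 + ε * b)) (by positivity)
    (by positivity) (by field_simp)
  convert h1 using 1
  have hb' : b = 1 - a := by linarith
  subst hb'
  match_scalars <;> field_simp <;> ring

lemma mem_intrinsicInterior_iff_ball {s : Set E} {x : E} :
    x ∈ intrinsicInterior ℝ s ↔
      x ∈ affineSpan ℝ s ∧ ∃ ε : ℝ, 0 < ε ∧ Metric.ball x ε ∩ affineSpan ℝ s ⊆ s := by
  rw [mem_intrinsicInterior]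
  constructor
  · rintro ⟨y, hy, rfl⟩
    refine ⟨y.2, ?_⟩
    obtain ⟨ε, hε, h⟩ := Metric.mem_nhds_iff.1 (mem_interior_iff_mem_nhds.1 hy)
    exact ⟨ε, hε, fun q hq => @h ⟨q, hq.2⟩ hq.1⟩
  · rintro ⟨hx, ε, hε, h⟩
    exact ⟨⟨x, hx⟩, mem_interior_iff_mem_nhds.2
      (Metric.mem_nhds_iff.2 ⟨ε, hε, fun q hq => h ⟨hq, q.2⟩⟩), rfl⟩

lemma eq_minFace_of_mem_intrinsicInterior {P F : Set E} (hP : Convex ℝ P) (hF : IsExtreme ℝ P F)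
    {x : E} (hx : x ∈ intrinsicInterior ℝ F) : F = minFace P x := by
  have hxF : x ∈ F := intrinsicInterior_subset hx
  have hxP : x ∈ P := hF.subset hxF
  obtain ⟨hxs, ε, hε, hball⟩ := mem_intrinsicInterior_iff_ball.1 hx
  ext q
  rw [mem_minFace hP hxP]
  constructor
  · intro hq
    refine ⟨hF.subset hq, ?_⟩
    have hlim : Tendsto (fun t : ℝ => x - t • (q - x)) (𝓝[>] 0) (𝓝 x) := by
      have : Continuous fun t : ℝ => x - t • (q - x) := by fun_prop
      simpa using (this.tendsto 0).mono_left nhdsWithin_le_nhds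
    obtain ⟨t, ht, ht0⟩ :=
      ((hlim.eventually (Metric.ball_mem_nhds x hε)).and self_mem_nhdsWithin).exists
    refine ⟨t, ht0, hF.subset (hball ⟨ht, ?_⟩)⟩
    have := AffineMap.lineMap_mem (-t) hxs (subset_affineSpan ℝ F hq)
    rw [AffineMap.lineMap_apply] at this
    simpa [sub_eq_add_neg, add_comm] using this
  · rintro ⟨hq, t, ht, h⟩
    refine hF.left_mem_of_mem_openSegment hq h hxF
      ⟨t / (1 + t), 1 / (1 + t), by positivity, by positivity, by field_simp; ring, ?_⟩
    match_scalars <;> field_simp <;> ring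

lemma mem_intrinsicInterior_minFace [FiniteDimensional ℝ E] {P : Set E} (hP : Convex ℝ P) {x : E}
    (hx : x ∈ P) : x ∈ intrinsicInterior ℝ (minFace P x) := by
  have hconv := convex_minFace hP x
  obtain ⟨c, hc⟩ := Set.Nonempty.intrinsicInterior hconv ⟨x, mem_minFace_self hx⟩
  have hcF := intrinsicInterior_subset hc
  obtain ⟨hc1, δ, hδ, hc2⟩ := mem_intrinsicInterior_iff_ball.1 hc
  obtain ⟨hcP, ε, hε, hb⟩ := (mem_minFace hP hx).1 hcF
  have hbF : x - ε • (c - x) ∈ minFace P x := by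
    refine (mem_minFace hP hx).2 ⟨hb, 1 / ε, by positivity, ?_⟩
    convert hcP using 1
    match_scalars <;> field_simp; ring
  have hspan := subset_affineSpan ℝ (minFace P x)
  refine mem_intrinsicInterior_iff_ball.2
    ⟨hspan (mem_minFace_self hx), ε / (1 + ε) * δ, by positivity, fun q hq => ?_⟩
  set r : E := c + ((1 + ε) / ε) • (q - x) with hr
  have hr1 : r ∈ affineSpan ℝ (minFace P x) := by
    have hdir := AffineSubspace.vsub_mem_direction hq.2 (hspan (mem_minFace_self hx))
    have := AffineSubspace.vadd_mem_of_mem_direction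
      (Submodule.smul_mem _ ((1 + ε) / ε) hdir) hc1
    rwa [vadd_eq_add, vsub_eq_sub, add_comm] at this
  have hr2 : r ∈ Metric.ball c δ := by
    have hq1 := hq.1
    rw [Metric.mem_ball, dist_eq_norm] at hq1 ⊢
    rw [hr, add_sub_cancel_left, norm_smul, Real.norm_eq_abs, abs_of_pos (by positivity)]
    calc (1 + ε) / ε * ‖q - x‖ < (1 + ε) / ε * (ε / (1 + ε) * δ) := by gcongr
      _ = δ := by field_simp
  have h := hconv (hc2 ⟨hr2, hr1⟩) hbF (a := ε / (1 + ε)) (b := 1 / (1 + ε)) (by positivity)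
    (by positivity) (by field_simp; ring)
  convert h using 1
  rw [hr]
  match_scalars <;> field_simp <;> ring

lemma direction_affineSpan_minFace {P : Set E} (hP : Convex ℝ P) {x : E} (hx : x ∈ P) :
    (affineSpan ℝ (minFace P x)).direction = Submodule.span ℝ (lineDirs P x) := by
  rw [direction_affineSpan, vectorSpan_eq_span_vsub_set_right ℝ (mem_minFace_self hx)]
  apply le_antisymm
  · rw [Submodule.span_le]
    rintro _ ⟨q, hq, rfl⟩
    exact Submodule.subset_span hq.2
  · rw [Submodule.span_le]
    intro d hd
    obtain ⟨ε, hε, h1, h2⟩ := (mem_lineDirs hP).1 hd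
    have h3 : x + ε • d ∈ minFace P x := by
      refine (mem_minFace hP hx).2 ⟨h1, 1, one_pos, ?_⟩
      simpa using h2
    have h4 : ε • d ∈ Submodule.span ℝ ((fun q => q -ᵥ x) '' minFace P x) :=
      Submodule.subset_span ⟨_, h3, by simp⟩
    have h5 := Submodule.smul_mem _ ε⁻¹ h4
    rwa [inv_smul_smul₀ hε.ne'] at h5

/-- A polytope agrees near each of its points with a cone. -/
lemma exists_expansion_mem_convexHull [FiniteDimensional ℝ E] (V : Finset E) {p : E}
    (hp : p ∈ convexHull ℝ (V : Set E)) :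
    ∃ r > 0, ∀ x ∈ convexHull ℝ (V : Set E), ‖x - p‖ < r →
      p + (2 : ℝ) • (x - p) ∈ convexHull ℝ (V : Set E) := by
  set P := convexHull ℝ (V : Set E) with hPdef
  have hconv : Convex ℝ P := convex_convexHull ℝ _
  have hcomp : IsCompact P := V.finite_toSet.isCompact_convexHull ℝ
  set K : Set E := ⋃ T ∈ V.powerset.filter (fun T : Finset E => p ∉ convexHull ℝ (T : Set E)),
    convexHull ℝ (T : Set E) with hK
  have hKclosed : IsClosed K :=
    Set.Finite.isClosed_biUnion (Finset.finite_toSet _)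
      fun T _ => T.finite_toSet.isClosed_convexHull ℝ
  have hpK : p ∉ K := by
    simp [hK]
  obtain ⟨δ, hδ, hball⟩ := Metric.mem_nhds_iff.1 (hKclosed.isOpen_compl.mem_nhds hpK)
  refine ⟨δ / 2, by positivity, fun x hx hxp => ?_⟩
  by_cases hne : x = p
  · subst hne; simpa using hx
  have hpos : 0 < ‖x - p‖ := norm_pos_iff.2 (sub_ne_zero.2 hne)
  have hTcomp : IsCompact {t : ℝ | p + t • (x - p) ∈ P} := by
    refine Metric.isCompact_of_isClosed_isBounded (hcomp.isClosed.preimage (by fun_prop)) ?_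
    obtain ⟨C, hC⟩ := hcomp.isBounded.exists_norm_le
    refine isBounded_iff_forall_norm_le.2 ⟨(C + ‖p‖) / ‖x - p‖, fun t ht => ?_⟩
    rw [le_div_iff₀ hpos, ← norm_smul]
    have h1 := hC _ ht
    have h2 := norm_sub_le (p + t • (x - p)) p
    rw [add_sub_cancel_left] at h2
    linarith
  obtain ⟨t, ht, hmax⟩ := hTcomp.exists_isGreatest ⟨1, by simpa using hx⟩
  have ht1 : 1 ≤ t := hmax (by simpa using hx)
  obtain ⟨w, hw0, hw1, hw⟩ := Finset.mem_convexHull'.1 (show p + t • (x - p) ∈ P from ht)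
  set T := V.filter fun s => 0 < w s with hT
  have hwT : ∀ s ∈ V, s ∉ T → w s = 0 := fun s hs hsT =>
    le_antisymm (not_lt.1 fun h => hsT (Finset.mem_filter.2 ⟨hs, h⟩)) (hw0 s hs)
  have hTV : T ⊆ V := Finset.filter_subset _ _
  have hw1T : ∑ s ∈ T, w s = 1 := by rw [← hw1]; exact Finset.sum_subset hTV hwT
  have hwT' : ∑ s ∈ T, w s • s = p + t • (x - p) := by
    rw [← hw]; exact Finset.sum_subset hTV fun s hs h => by rw [hwT s hs h, zero_smul]
  have hqT : p + t • (x - p) ∈ convexHull ℝ (T : Set E) :=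
    Finset.mem_convexHull'.2 ⟨w, fun s hs => (Finset.mem_filter.1 hs).2.le, hw1T, hwT'⟩
  have hpT : p ∉ convexHull ℝ (T : Set E) := by
    intro hpT
    obtain ⟨μ, hμ0, hμ1, hμ⟩ := Finset.mem_convexHull'.1 hpT
    have hev : ∀ᶠ ε in 𝓝[>] (0 : ℝ), ∀ s ∈ T, 0 < w s + ε * (w s - μ s) := by
      rw [eventually_all_finset]
      intro s hs
      have hcont : Continuous fun ε : ℝ => w s + ε * (w s - μ s) := by fun_prop
      have h0 : (0 : ℝ) < w s + 0 * (w s - μ s) := by simpa using (Finset.mem_filter.1 hs).2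
      exact nhdsWithin_le_nhds (hcont.continuousAt.eventually (lt_mem_nhds h0))
    obtain ⟨ε, hε, hε0⟩ := (hev.and self_mem_nhdsWithin).exists
    have hε0 : 0 < ε := hε0
    have hmem : p + (t * (1 + ε)) • (x - p) ∈ P := by
      refine convexHull_mono (Finset.coe_subset.2 hTV) (Finset.mem_convexHull'.2
        ⟨fun s => w s + ε * (w s - μ s), fun s hs => (hε s hs).le, ?_, ?_⟩)
      · rw [Finset.sum_add_distrib, ← Finset.mul_sum, Finset.sum_sub_distrib, hw1T, hμ1]; ring
      · simp only [add_smul, mul_smul, sub_smul, Finset.sum_add_distrib, ← Finset.smul_sum,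
          Finset.sum_sub_distrib, hwT', hμ]
        module
    have := hmax hmem
    nlinarith
  have hqK : p + t • (x - p) ∈ K := by
    rw [hK]
    exact Set.mem_biUnion (Finset.mem_coe.2
      (Finset.mem_filter.2 ⟨Finset.mem_powerset.2 hTV, hpT⟩)) hqT
  have hfar : δ ≤ t * ‖x - p‖ := by
    by_contra! h
    refine hball (Metric.mem_ball.2 ?_) hqK
    rwa [dist_eq_norm, add_sub_cancel_left, norm_smul, Real.norm_eq_abs,
      abs_of_pos (by linarith)]
  have ht2 : 2 ≤ t := by
    by_contra! h
    nlinarith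
  have h1 := hconv.add_smul_sub_mem hp ht (t := 2 / t)
    ⟨by positivity, (div_le_one (by linarith)).2 ht2⟩
  rwa [add_sub_cancel_left, smul_smul, div_mul_cancel₀ _ (by linarith)] at h1

lemma polyWeight_locally_invariant [FiniteDimensional ℝ E] (V : Finset E) {p l : E}
    (hp : p ∈ convexHull ℝ (V : Set E)) (hl : l ∈ lineDirs (convexHull ℝ (V : Set E)) p) (y : ℂ) :
    ∃ r > 0, ∀ x ∈ Metric.ball p r, ∀ t : ℝ, x + t • l ∈ Metric.ball p r →
      polyWeight y (convexHull ℝ (V : Set E)) x =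
        polyWeight y (convexHull ℝ (V : Set E)) (x + t • l) := by
  obtain ⟨r₁, hr₁, h₁⟩ := exists_expansion_mem_convexHull V hp
  obtain ⟨r₂, hr₂, h₂⟩ := Metric.eventually_nhds_iff.1 hl
  have hmove : ∀ x ∈ convexHull ℝ (V : Set E), ‖x - p‖ < r₁ → ∀ t : ℝ, |t| < r₂ / 2 →
      x + t • l ∈ convexHull ℝ (V : Set E) := by
    intro x hx hxp t ht
    have h3 := h₁ x hx hxp
    have h4 := @h₂ (2 * t) (by
      rw [Real.dist_eq, sub_zero, abs_mul, abs_two]; linarith)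
    have := convex_convexHull ℝ (V : Set E) h3 h4 (a := 1 / 2) (b := 1 / 2) (by norm_num)
      (by norm_num) (by norm_num)
    convert this using 1
    module
  rcases eq_or_ne l 0 with rfl | hl0
  · exact ⟨1, one_pos, fun x _ t _ => by simp⟩
  have hlpos : 0 < ‖l‖ := norm_pos_iff.2 hl0
  refine ⟨min r₁ (r₂ / 4 * ‖l‖), lt_min hr₁ (by positivity), fun x hx t hxt => ?_⟩
  have ht' : |t| < r₂ / 2 := by
    have h1 : ‖t • l‖ < r₂ / 4 * ‖l‖ + r₂ / 4 * ‖l‖ := by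
      have hx1 := (Metric.mem_ball.1 hx).trans_le (min_le_right _ _)
      have hx2 := (Metric.mem_ball.1 hxt).trans_le (min_le_right _ _)
      have := dist_triangle_right (x + t • l) x p
      rw [dist_eq_norm, add_sub_cancel_left] at this
      linarith
    rw [norm_smul, Real.norm_eq_abs] at h1
    nlinarith
  apply polyWeight_congr
  have hcont : Continuous fun z : E => z + t • l := by fun_prop
  filter_upwards [Metric.isOpen_ball.mem_nhds hx,
    hcont.continuousAt.preimage_mem_nhds (Metric.isOpen_ball.mem_nhds hxt)] with z hz hz'
  rw [Metric.mem_ball, dist_eq_norm] at hz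
  rw [Set.mem_preimage, Metric.mem_ball, dist_eq_norm] at hz'
  constructor
  · intro h
    exact hmove z h (hz.trans_le (min_le_left _ _)) t ht'
  · intro h
    have := hmove _ h (hz'.trans_le (min_le_left _ _)) (-t) (by rwa [abs_neg])
    simpa using this

/-- At a point of a polytope which is not one of the spanning points, the difference of two distinct
spanning points is a direction of a line segment around the point. -/
lemma exists_sub_mem_lineDirs (V : Finset E) {p : E} (hp : p ∈ convexHull ℝ (V : Set E))
    (hpV : p ∉ V) : ∃ s ∈ V, ∃ s' ∈ V, s ≠ s' ∧
      s - s' ∈ lineDirs (convexHull ℝ (V : Set E)) p := by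
  obtain ⟨w, hw0, hw1, hw⟩ := Finset.mem_convexHull'.1 hp
  obtain ⟨s, hs, hws⟩ : ∃ s ∈ V, 0 < w s := by
    by_contra! h
    have : ∑ s ∈ V, w s ≤ 0 := Finset.sum_nonpos h
    linarith
  obtain ⟨s', hs', hss', hws'⟩ : ∃ s' ∈ V, s' ≠ s ∧ 0 < w s' := by
    by_contra! h
    have h0 : ∀ s' ∈ V, s' ≠ s → w s' = 0 := fun s' hs' hne =>
      le_antisymm (h s' hs' hne) (hw0 s' hs')
    have h1 : w s = 1 := by rw [← hw1, Finset.sum_eq_single_of_mem s hs h0]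
    have h2 : p = s := by
      rw [← hw, Finset.sum_eq_single_of_mem s hs fun b hb hne => by rw [h0 b hb hne, zero_smul],
        h1, one_smul]
    exact hpV (h2 ▸ hs)
  refine ⟨s, hs, s', hs', hss'.symm, (mem_lineDirs (convex_convexHull ℝ _)).2
    ⟨min (w s) (w s'), lt_min hws hws', ?_⟩⟩
  set ε := min (w s) (w s')
  have hmem : ∀ c : ℝ, |c| ≤ ε → p + c • (s - s') ∈ convexHull ℝ (V : Set E) := by
    intro c hc
    obtain ⟨hc1, hc2⟩ := abs_le.1 hc
    refine Finset.mem_convexHull'.2 ⟨fun r => w r + ((if r = s then c else 0) -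
      (if r = s' then c else 0)), fun r hr => ?_, ?_, ?_⟩
    · have h1 : ε ≤ w s := min_le_left _ _
      have h2 : ε ≤ w s' := min_le_right _ _
      have h3 := hw0 r hr
      beta_reduce
      split_ifs with h4 h5 h5
      · linarith
      · subst h4; linarith
      · subst h5; linarith
      · linarith
    · simp [Finset.sum_add_distrib, hw1, hs, hs']
    · simp only [add_smul, sub_smul, ite_smul, zero_smul, Finset.sum_add_distrib,
        Finset.sum_sub_distrib, Finset.sum_ite_eq', hs, hs', if_true, hw, smul_sub]
  have hε : 0 < ε := lt_min hws hws'
  refine ⟨hmem ε (abs_of_pos hε).le, ?_⟩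
  have := hmem (-ε) (by rw [abs_neg]; exact (abs_of_pos hε).le)
  rwa [neg_smul, ← sub_eq_add_neg] at this

end Convexity

/-! ### Comparison of a polytope with its vertex cones -/

section VertexCones

variable {n : ℕ}

open AddMonoidAlgebra Filter Topology

variable {u : Fin n → Fin n → ℤ} {m : Fin n → Fin n → ℚ}

lemma mem_tanConeN {v x : Fin n → ℝ} : x ∈ tanConeN v u ↔ ∀ j, 0 ≤ coneCoord v u j x := Iff.rfl

lemma lineDirs_tanConeN {v x : Fin n → ℝ} (hx : x ∈ tanConeN v u) :
    lineDirs (tanConeN v u) x = {d | ∀ j, coneCoord v u j x = 0 → ∑ i, d i * (u j i : ℝ) = 0} := by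
  have hadd : ∀ (t : ℝ) (d : Fin n → ℝ) j,
      coneCoord v u j (x + t • d) = coneCoord v u j x + t * ∑ i, d i * (u j i : ℝ) := by
    intro t d j
    rw [coneCoord, coneCoord, Finset.mul_sum, ← Finset.sum_add_distrib]
    refine Finset.sum_congr rfl fun i _ => ?_
    simp only [Pi.add_apply, Pi.smul_apply, smul_eq_mul]
    ring
  ext d
  constructor
  · intro hd j hj
    obtain ⟨ε, hε, h⟩ := Metric.eventually_nhds_iff.1 hd
    have hhalf : |ε / 2| < ε := by rw [abs_of_pos (by positivity)]; linarith
    have h1 := mem_tanConeN.1 (@h (ε / 2) (by rwa [Real.dist_eq, sub_zero])) j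
    have h2 := mem_tanConeN.1 (@h (-(ε / 2)) (by rwa [Real.dist_eq, sub_zero, abs_neg])) j
    rw [hadd, hj, zero_add] at h1 h2
    have h3 := nonneg_of_mul_nonneg_right h1 (by positivity)
    nlinarith
  · intro hd
    refine (eventually_all.2 fun j => ?_ : ∀ᶠ t in 𝓝 (0 : ℝ), ∀ j, 0 ≤ coneCoord v u j (x + t • d))
    rcases (mem_tanConeN.1 hx j).eq_or_lt with hj | hj
    · refine Eventually.of_forall fun t => ?_
      rw [hadd, hd j hj.symm, ← hj]; simp
    · have hcont : Continuous fun t : ℝ => coneCoord v u j x + t * ∑ i, d i * (u j i : ℝ) := by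
        fun_prop
      have h0 : 0 < coneCoord v u j x + 0 * ∑ i, d i * (u j i : ℝ) := by simpa using hj
      filter_upwards [hcont.continuousAt.eventually (lt_mem_nhds h0)] with t ht
      rw [hadd]; exact ht.le

lemma polyWeight_tanConeN (hdual : ∀ i j, ∑ k, m i k * (u j k : ℚ) = if i = j then 1 else 0)
    (y : ℂ) (v x : Fin n → ℝ) : polyWeight y (tanConeN v u) x = coneWeight y v u x := by
  by_cases hx : x ∈ tanConeN v u
  · have hspan : Submodule.span ℝ (lineDirs (tanConeN v u) x) = Submodule.span ℝ
        (Set.range fun j : {j // coneCoord v u j x ≠ 0} => castQ (m j)) := by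
      rw [lineDirs_tanConeN hx]
      apply le_antisymm
      · rw [Submodule.span_le]
        intro d hd
        rw [← sum_pairing_smul_eq hdual d]
        refine Submodule.sum_mem _ fun j _ => ?_
        by_cases hj : coneCoord v u j x = 0
        · rw [hd j hj, zero_smul]; exact Submodule.zero_mem _
        · exact Submodule.smul_mem _ _ (Submodule.subset_span ⟨⟨j, hj⟩, rfl⟩)
      · refine Submodule.span_mono ?_
        rintro _ ⟨⟨i, hi⟩, rfl⟩ j hj
        have hij : i ≠ j := fun h => hi (h ▸ hj)
        have := dual_real hdual i j
        rwa [if_neg hij] at this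
    have hrank : Module.finrank ℝ (Submodule.span ℝ (lineDirs (tanConeN v u) x)) =
        (Finset.univ.filter fun j => coneCoord v u j x ≠ 0).card := by
      have hli : LinearIndependent ℝ fun j : {j // coneCoord v u j x ≠ 0} => castQ (m j) :=
        (linearIndependent_castQ hdual).comp _ Subtype.val_injective
      rw [hspan, finrank_span_eq_card hli, Fintype.card_subtype]
    rw [polyWeight, if_pos hx, hrank, coneWeight, ← Finset.prod_const, Finset.prod_filter]
    refine Finset.prod_congr rfl fun j _ => ?_
    rw [rayWeight, if_neg (mem_tanConeN.1 hx j).not_gt]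
    simp only [ne_eq, ite_not]
  · rw [polyWeight, if_neg hx]
    rw [mem_tanConeN] at hx
    push Not at hx
    obtain ⟨j, hj⟩ := hx
    rw [coneWeight]
    exact (Finset.prod_eq_zero (Finset.mem_univ j) (by rw [rayWeight, if_pos hj])).symm

lemma one_le_norm_castZ_sub {v w : Fin n → ℤ} (h : v ≠ w) : 1 ≤ ‖castZ v - castZ w‖ := by
  obtain ⟨i, hi⟩ := Function.ne_iff.1 h
  refine le_trans ?_ (norm_le_pi_norm (castZ v - castZ w) i)
  have h1 : 1 ≤ |v i - w i| := Int.one_le_abs (sub_ne_zero.2 hi)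
  rw [Pi.sub_apply, castZ, castZ, Real.norm_eq_abs]
  exact_mod_cast h1

/-- The difference operators of small steps in the directions of `L`. -/
def stepOp (L : Finset (Fin n → ℝ)) (s : ℝ) : AddMonoidAlgebra ℂ (Fin n → ℝ) :=
  ∏ l ∈ L, (1 - single (s • l) 1)

lemma sum_norm_smul_le {T L : Finset (Fin n → ℝ)} (h : T ⊆ L) {s : ℝ} (hs : 0 ≤ s) :
    ∑ l ∈ T, ‖s • l‖ ≤ s * ∑ l ∈ L, ‖l‖ := by
  simp only [norm_smul, Real.norm_eq_abs, abs_of_nonneg hs]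
  rw [← Finset.mul_sum]
  exact mul_le_mul_of_nonneg_left
    (Finset.sum_le_sum_of_subset_of_nonneg h fun _ _ _ => norm_nonneg _) hs

lemma act_stepOp_eq_of_ball (L : Finset (Fin n → ℝ)) {s : ℝ} (hs : 0 ≤ s)
    {φ φ' : (Fin n → ℝ) → ℂ} {x : Fin n → ℝ}
    (h : ∀ x', ‖x' - x‖ ≤ s * ∑ l ∈ L, ‖l‖ → φ x' = φ' x') :
    act (stepOp L s) φ x = act (stepOp L s) φ' x := by
  have := act_prod_eq_zero_of_ball L (fun l => s • l) (φ - φ') x fun x' hx' =>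
    sub_eq_zero.2 (h x' (hx'.trans (sum_norm_smul_le subset_rfl hs)))
  rw [map_sub] at this
  exact sub_eq_zero.1 this

lemma act_stepOp_eq_zero {T L : Finset (Fin n → ℝ)} (hT : T ⊆ L) {s : ℝ}
    {φ : (Fin n → ℝ) → ℂ} {x : Fin n → ℝ}
    (h : ∀ x', ‖x' - x‖ ≤ ∑ l ∈ L \ T, ‖s • l‖ → act (stepOp T s) φ x' = 0) :
    act (stepOp L s) φ x = 0 := by
  rw [stepOp, ← Finset.prod_sdiff hT, act_mul]
  exact act_prod_eq_zero_of_ball _ _ _ _ h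

lemma act_stepOp_coneWeight_eq_zero
    (hdual : ∀ i j, ∑ k, m i k * (u j k : ℚ) = if i = j then 1 else 0) (y : ℂ) (v : Fin n → ℝ)
    {L : Finset (Fin n → ℝ)} (hL : ∀ i, castQ (m i) ∈ L) {s : ℝ} (hs : 0 ≤ s) {x : Fin n → ℝ}
    (hx : 2 * (s * ∑ l ∈ L, ‖l‖) < ‖x - v‖) :
    act (stepOp L s) (coneWeight y v u) x = 0 := by
  have hinj : Function.Injective fun i => castQ (m i) := (linearIndependent_castQ hdual).injective
  have hT : Finset.univ.image (fun i => castQ (m i)) ⊆ L := by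
    intro l hl
    obtain ⟨i, -, rfl⟩ := Finset.mem_image.1 hl
    exact hL i
  refine act_stepOp_eq_zero hT fun x' hx' => ?_
  rw [stepOp, Finset.prod_image fun i _ j _ h => hinj h]
  refine act_prod_coneWeight_eq_zero hdual y v hs ?_
  have h1 : s * ∑ i, ‖castQ (m i)‖ ≤ s * ∑ l ∈ L, ‖l‖ := by
    refine mul_le_mul_of_nonneg_left ?_ hs
    rw [← Finset.sum_image (f := fun l => ‖l‖) fun i _ j _ h => hinj h]
    exact Finset.sum_le_sum_of_subset_of_nonneg hT fun _ _ _ => norm_nonneg _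
  have h2 := hx'.trans (sum_norm_smul_le Finset.sdiff_subset hs)
  have h3 := norm_sub_le_norm_sub_add_norm_sub x x' v
  rw [norm_sub_rev x x'] at h3
  linarith

/-- Up to torsion, the weight function of a simple lattice polytope is the sum of the weight
functions of its vertex cones. -/
lemma exists_act_stepOp_eq_zero {V : Finset (Fin n → ℤ)} {P : Set (Fin n → ℝ)}
    (hP : P = convexHull ℝ (castZ '' (V : Set (Fin n → ℤ))))
    {uV : (Fin n → ℤ) → Fin n → Fin n → ℤ} {mV : (Fin n → ℤ) → Fin n → Fin n → ℚ}
    (htan : ∀ v ∈ V, ∃ ε > 0, P ∩ Metric.ball (castZ v) ε =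
      tanConeN (castZ v) (uV v) ∩ Metric.ball (castZ v) ε)
    (hdual : ∀ v ∈ V, ∀ i j, ∑ k, mV v i k * (uV v j k : ℚ) = if i = j then 1 else 0)
    (y : ℂ) {L : Finset (Fin n → ℝ)}
    (hL : ∀ v ∈ V, ∀ w ∈ V, v ≠ w → castZ v - castZ w ∈ L)
    (hLm : ∀ v ∈ V, ∀ i, castQ (mV v i) ∈ L) :
    ∃ k : ℕ, 0 < k ∧ act (stepOp L (k : ℝ)⁻¹)
      (polyWeight y P - ∑ v ∈ V, coneWeight y (castZ v) (uV v)) = 0 := by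
  have hP' : P = convexHull ℝ ((V.image castZ : Finset (Fin n → ℝ)) : Set (Fin n → ℝ)) := by
    rw [hP, Finset.coe_image]
  have hcomp : IsCompact P := by rw [hP']; exact (Finset.finite_toSet _).isCompact_convexHull ℝ
  set C := ∑ l ∈ L, ‖l‖ with hC
  have hC0 : 0 ≤ C := Finset.sum_nonneg fun _ _ => norm_nonneg _
  have hvertex : ∀ v ∈ V, ∃ ε > 0, ∀ x ∈ Metric.ball (castZ v) ε,
      polyWeight y P x = coneWeight y (castZ v) (uV v) x := by
    intro v hv
    obtain ⟨ε, hε, h⟩ := htan v hv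
    refine ⟨ε, hε, fun x hx => ?_⟩
    rw [← polyWeight_tanConeN (hdual v hv)]
    have hev : ∀ᶠ z in 𝓝 x, z ∈ P ↔ z + 0 ∈ tanConeN (castZ v) (uV v) := by
      filter_upwards [Metric.isOpen_ball.mem_nhds hx] with z hz
      have := Set.ext_iff.1 h z
      simpa [Set.mem_inter_iff, hz] using this
    have := polyWeight_congr hev y
    rwa [add_zero] at this
  choose! ε hε hεw using hvertex
  have hlocal : ∀ p ∈ P, ∃ r > 0,
      (∃ v ∈ V, ∀ x ∈ Metric.ball p r, polyWeight y P x = coneWeight y (castZ v) (uV v) x) ∨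
      (∃ l ∈ L, ∀ x ∈ Metric.ball p r, ∀ t : ℝ, x + t • l ∈ Metric.ball p r →
        polyWeight y P x = polyWeight y P (x + t • l)) := by
    intro p hp
    by_cases hpV : p ∈ V.image castZ
    · obtain ⟨v, hv, rfl⟩ := Finset.mem_image.1 hpV
      exact ⟨ε v, hε v hv, Or.inl ⟨v, hv, hεw v hv⟩⟩
    · rw [hP'] at hp
      obtain ⟨s, hs, s', hs', hne, hdir⟩ := exists_sub_mem_lineDirs _ hp hpV
      obtain ⟨r, hr, h⟩ := polyWeight_locally_invariant _ hp hdir y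
      obtain ⟨v, hv, rfl⟩ := Finset.mem_image.1 hs
      obtain ⟨w, hw, rfl⟩ := Finset.mem_image.1 hs'
      rw [← hP'] at h
      exact ⟨r, hr, Or.inr ⟨_, hL v hv w hw fun e => hne (e ▸ rfl), h⟩⟩
  choose! r hr hlocal using hlocal
  obtain ⟨δ, hδ, hleb⟩ := lebesgue_number_lemma_of_metric (c := fun p : P => Metric.ball p.1 (r p))
    hcomp (fun _ => Metric.isOpen_ball)
    (fun p hp => Set.mem_iUnion.2 ⟨⟨p, hp⟩, Metric.mem_ball_self (hr p hp)⟩)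
  have hlim : Tendsto (fun k : ℕ => 4 * ((k : ℝ)⁻¹ * C)) atTop (𝓝 0) := by
    simpa using ((tendsto_inv_atTop_nhds_zero_nat (𝕜 := ℝ)).mul_const C).const_mul 4
  obtain ⟨k, ⟨⟨hk0, hkδ⟩, hk1⟩, hkε⟩ := ((((eventually_gt_atTop 0).and
    (hlim.eventually (gt_mem_nhds hδ))).and (hlim.eventually (gt_mem_nhds one_pos))).and
    ((Filter.eventually_all_finset V).2 fun v hv =>
      hlim.eventually (gt_mem_nhds (hε v hv)))).exists
  refine ⟨k, hk0, funext fun x => ?_⟩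
  set s : ℝ := (k : ℝ)⁻¹ with hs
  have hs0 : 0 ≤ s := by positivity
  have hsC : 0 ≤ s * C := mul_nonneg hs0 hC0
  have hcone : ∀ v ∈ V, 2 * (s * C) < ‖x - castZ v‖ →
      act (stepOp L s) (coneWeight y (castZ v) (uV v)) x = 0 := fun v hv hx =>
    act_stepOp_coneWeight_eq_zero (hdual v hv) y (castZ v) (hLm v hv) hs0 hx
  simp only [map_sub, map_sum, Pi.sub_apply, Finset.sum_apply, Pi.zero_apply]
  by_cases hnear : ∃ v ∈ V, ‖x - castZ v‖ ≤ 2 * (s * C)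
  · obtain ⟨v, hv, hxv⟩ := hnear
    rw [Finset.sum_eq_single_of_mem v hv, sub_eq_zero]
    · refine act_stepOp_eq_of_ball L hs0 fun x' hx' => hεw v hv x' ?_
      rw [Metric.mem_ball, dist_eq_norm]
      have := norm_sub_le_norm_sub_add_norm_sub x' x (castZ v)
      linarith [hkε v hv]
    · intro w hw hwv
      refine hcone w hw ?_
      have h1 := one_le_norm_castZ_sub hwv
      have h2 := norm_sub_le_norm_sub_add_norm_sub (castZ w) x (castZ v)
      rw [norm_sub_rev (castZ w) x] at h2
      linarith
  · push Not at hnear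
    rw [Finset.sum_eq_zero fun v hv => hcone v hv (hnear v hv), sub_zero]
    by_cases hxP : ∃ x' ∈ P, ‖x' - x‖ ≤ s * C
    · obtain ⟨x', hx'P, hx'⟩ := hxP
      obtain ⟨⟨p, hp⟩, hpball⟩ := hleb x' hx'P
      have hball : ∀ x'', ‖x'' - x‖ ≤ s * C → x'' ∈ Metric.ball p (r p) := by
        intro x'' hx''
        apply hpball
        rw [Metric.mem_ball, dist_eq_norm]
        have := norm_sub_le_norm_sub_add_norm_sub x'' x x'
        rw [norm_sub_rev x x'] at this
        linarith
      rcases hlocal p hp with ⟨v, hv, h⟩ | ⟨l, hl, h⟩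
      · rw [← hcone v hv (hnear v hv)]
        exact act_stepOp_eq_of_ball L hs0 fun x'' hx'' => h x'' (hball x'' hx'')
      · refine act_stepOp_eq_zero (Finset.singleton_subset_iff.2 hl) fun x'' hx'' => ?_
        rw [stepOp, Finset.prod_singleton, act_one_sub_single, sub_eq_zero]
        have hsum : ∑ l' ∈ L \ {l}, ‖s • l'‖ + ‖s • l‖ ≤ s * C := by
          rw [← Finset.sum_singleton (fun l' => ‖s • l'‖) l,
            Finset.sum_sdiff (Finset.singleton_subset_iff.2 hl)]
          exact sum_norm_smul_le subset_rfl hs0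
        have hmove := h x'' (hball x'' (by linarith [norm_nonneg (s • l)])) (-s)
        rw [neg_smul, ← sub_eq_add_neg] at hmove
        refine hmove (hball _ ?_)
        have := norm_sub_le (x'' - x) (s • l)
        rw [sub_right_comm] at this
        linarith
    · push Not at hxP
      have hzero := act_stepOp_eq_of_ball L hs0 (φ := polyWeight y P) (φ' := 0) (x := x)
        fun x' hx' => if_neg fun h => (hxP x' h).not_ge hx'
      rw [hzero, map_zero]; rfl

end VertexCones

/-! ### Lattice points of a polytope -/

section LatticePoints

variable {n : ℕ}

open AddMonoidAlgebra

lemma finite_setOf_castZ_mem {P : Set (Fin n → ℝ)} (hP : Bornology.IsBounded P) :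
    {x : Fin n → ℤ | castZ x ∈ P}.Finite := by
  obtain ⟨C, hC⟩ := hP.exists_norm_le
  refine (Set.finite_Icc (fun _ => -⌈C⌉ : Fin n → ℤ) fun _ => ⌈C⌉).subset fun x hx => ?_
  have h : ∀ i, |x i| ≤ ⌈C⌉ := fun i => by
    have h1 := ((norm_le_pi_norm (castZ x) i).trans (hC _ hx)).trans (Int.le_ceil C)
    rw [castZ, Real.norm_eq_abs] at h1
    exact_mod_cast h1
  exact ⟨fun i => (abs_le.1 (h i)).1, fun i => (abs_le.1 (h i)).2⟩

/-- The weighted sum over the lattice points of all relative interiors of faces is the sum over the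
lattice points of the polytope, weighted by `polyWeight`. -/
lemma finsum_faces_eq {P : Set (Fin n → ℝ)} (hP : Convex ℝ P) {Λ : Finset (Fin n → ℤ)}
    (hΛ : ∀ x, x ∈ Λ ↔ castZ x ∈ P) (y : ℂ) (f : (Fin n → ℤ) → ℂ) :
    ∑ᶠ (E : Set (Fin n → ℝ)) (_ : IsFaceOf P E),
        (1 + y) ^ Module.finrank ℝ (affineSpan ℝ E).direction *
          ∑ᶠ (x : Fin n → ℤ) (_ : castZ x ∈ intrinsicInterior ℝ E), f x
      = ∑ x ∈ Λ, polyWeight y P (castZ x) * f x := by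
  have hface : ∀ E : Set (Fin n → ℝ), (∑ᶠ (_ : IsFaceOf P E),
      (1 + y) ^ Module.finrank ℝ (affineSpan ℝ E).direction *
        ∑ᶠ (x : Fin n → ℤ) (_ : castZ x ∈ intrinsicInterior ℝ E), f x) =
      ∑ x ∈ Λ, if E = minFace P (castZ x) then polyWeight y P (castZ x) * f x else 0 := by
    intro E
    rw [finsum_eq_if]
    split_ifs with hE
    · obtain ⟨-, -, hext⟩ := hE
      have hiff : ∀ x ∈ Λ, castZ x ∈ intrinsicInterior ℝ E ↔ E = minFace P (castZ x) :=
        fun x hx => ⟨eq_minFace_of_mem_intrinsicInterior hP hext, fun h => by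
          have := mem_intrinsicInterior_minFace hP ((hΛ x).1 hx)
          rwa [← h] at this⟩
      rw [finsum_eq_sum_of_support_subset (s := Λ), Finset.mul_sum]
      · refine Finset.sum_congr rfl fun x hx => ?_
        rw [finsum_eq_if]
        simp only [hiff x hx]
        split_ifs with h
        · rw [polyWeight, if_pos ((hΛ x).1 hx), h, direction_affineSpan_minFace hP ((hΛ x).1 hx)]
        · rw [mul_zero]
      · intro x hx
        rw [Function.mem_support, finsum_eq_if] at hx
        have h := of_not_not fun h => hx (if_neg h)
        exact (hΛ x).2 (hext.subset (intrinsicInterior_subset h))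
    · refine (Finset.sum_eq_zero fun x hx => if_neg ?_).symm
      rintro rfl
      have hxP := (hΛ x).1 hx
      exact hE ⟨⟨_, mem_minFace_self hxP⟩, convex_minFace hP _, isExtreme_minFace hP hxP⟩
  rw [finsum_congr hface, finsum_eq_sum_of_support_subset
    (s := Λ.image fun x => minFace P (castZ x)), Finset.sum_comm]
  · refine Finset.sum_congr rfl fun x hx => ?_
    rw [Finset.sum_ite_eq', if_pos (Finset.mem_image_of_mem _ hx)]
  · intro E hE
    obtain ⟨x, hx, hne⟩ := Finset.exists_ne_zero_of_sum_ne_zero hE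
    have h := of_not_not fun h => hne (if_neg h)
    exact Finset.mem_coe.2 (Finset.mem_image.2 ⟨x, hx, h.symm⟩)

lemma eq_convexHull_extremePoints {S : Finset (Fin n → ℤ)} {P : Set (Fin n → ℝ)}
    (hP : P = convexHull ℝ (castZ '' ↑S)) :
    P = convexHull ℝ (castZ '' (S.filter fun v => castZ v ∈ P.extremePoints ℝ :
      Finset (Fin n → ℤ))) := by
  have hfin : (castZ '' (S : Set (Fin n → ℤ))).Finite := S.finite_toSet.image _
  have hext : castZ '' (S.filter fun v => castZ v ∈ P.extremePoints ℝ : Finset (Fin n → ℤ)) =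
      P.extremePoints ℝ := by
    apply Set.Subset.antisymm
    · rintro _ ⟨v, hv, rfl⟩
      exact (Finset.mem_filter.1 hv).2
    · intro x hx
      obtain ⟨v, hv, rfl⟩ : x ∈ castZ '' (S : Set (Fin n → ℤ)) :=
        extremePoints_convexHull_subset (𝕜 := ℝ) (by rwa [← hP])
      exact ⟨v, Finset.mem_filter.2 ⟨hv, hx⟩, rfl⟩
  have hclosed : IsClosed (convexHull ℝ (P.extremePoints ℝ)) := by
    rw [← hext]
    exact ((Finset.finite_toSet _).image _).isClosed_convexHull ℝ
  have hcomp : IsCompact P := by rw [hP]; exact hfin.isCompact_convexHull ℝ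
  have hconv : Convex ℝ P := by rw [hP]; exact convex_convexHull ℝ _
  rw [hext, ← hclosed.closure_eq, closure_convexHull_extremePoints hcomp hconv]

/-- Finitely many vectors with a positive integer multiple in the lattice have a common such
multiple. -/
lemma exists_common_smul_mem (L : Finset (Fin n → ℝ))
    (h : ∀ l ∈ L, ∃ N : ℕ, 0 < N ∧ N • l ∈ intLatR n) :
    ∃ N : ℕ, 0 < N ∧ ∀ l ∈ L, N • l ∈ intLatR n := by
  choose! N hN hNl using h
  refine ⟨∏ l ∈ L, N l, Finset.prod_pos hN, fun l hl => ?_⟩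
  obtain ⟨k, hk⟩ := Finset.dvd_prod_of_mem N hl
  rw [hk, mul_comm, mul_smul]
  exact (intLatR n).nsmul_mem (hNl l hl) k

/-- A difference of functions killed by small steps is, on the lattice, killed by a nonzero element
of the group algebra. -/
lemma exists_ne_zero_act_indicator_eq_zero {L : Finset (Fin n → ℝ)} (hL0 : ∀ l ∈ L, l ≠ 0)
    (hL : ∀ l ∈ L, ∃ N : ℕ, 0 < N ∧ N • l ∈ intLatR n) {k : ℕ} (hk : 0 < k)
    {φ : (Fin n → ℝ) → ℂ} (hφ : act (stepOp L (k : ℝ)⁻¹) φ = 0) :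
    ∃ D : AddMonoidAlgebra ℂ (Fin n → ℝ), D ≠ 0 ∧
      act D ((intLatR n : Set (Fin n → ℝ)).indicator φ) = 0 := by
  obtain ⟨N, hN, hNL⟩ := exists_common_smul_mem L hL
  refine ⟨∏ l ∈ L, (1 - single (N • l) 1), ?_, ?_⟩
  · exact Finset.prod_ne_zero_iff.2 fun l hl =>
      one_sub_single_ne_zero (smul_ne_zero hN.ne' (hL0 l hl))
  · have hdvd : stepOp L (k : ℝ)⁻¹ ∣ ∏ l ∈ L, (1 - single (N • l) 1) := by
      refine Finset.prod_dvd_prod_of_dvd _ _ fun l _ => ?_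
      have h := one_sub_single_dvd ((k : ℝ)⁻¹ • l) (N * k)
      have hk' : (k : ℝ) ≠ 0 := by exact_mod_cast hk.ne'
      rwa [mul_smul, ← Nat.cast_smul_eq_nsmul ℝ k, smul_inv_smul₀ hk'] at h
    obtain ⟨c, hc⟩ := hdvd
    rw [act_prod_indicator L _ hNL, hc, mul_comm, act_mul, hφ, map_zero, Set.indicator_zero']

lemma exists_coeff_eq_indicator {w : (Fin n → ℝ) → ℂ} {Λ : Finset (Fin n → ℤ)}
    (hΛ : ∀ x, x ∉ Λ → w (castZ x) = 0) (z : Fin n → ℂ) :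
    ∃ f : AddMonoidAlgebra ℂ (Fin n → ℝ),
      (f.coeff : (Fin n → ℝ) → ℂ) = (intLatR n : Set (Fin n → ℝ)).indicator w ∧
      expEval z f = ∑ x ∈ Λ, w (castZ x) * Complex.exp (pairCZ x z) := by
  refine ⟨∑ x ∈ Λ, single (castZ x) (w (castZ x)), ?_, ?_⟩
  · funext p
    rw [coeff_sum, Finsupp.finsetSum_apply]
    simp only [coeff_single, Finsupp.single_apply]
    by_cases hp : p ∈ intLatR n
    · obtain ⟨x, rfl⟩ := mem_intLatR.1 hp
      rw [Set.indicator_of_mem hp]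
      simp only [castZ_injective.eq_iff]
      rw [Finset.sum_ite_eq']
      split_ifs with hx
      · rfl
      · exact (hΛ x hx).symm
    · rw [Set.indicator_of_notMem hp]
      refine Finset.sum_eq_zero fun x _ => if_neg ?_
      rintro rfl
      exact hp (castZ_mem_intLatR x)
  · rw [map_sum]
    exact Finset.sum_congr rfl fun x _ => expEval_castZ _ _ _

end LatticePoints

/-- Let `P ⊂ ℝ^n` be a full-dimensional simple lattice polytope; for a
vertex `v` let `u_{v,1},…,u_{v,n}` be the primitive inward normals of the facets through `v`
(cutting out the tangent cone of `P` at `v`), `M'_v` the dual lattice, of index `d_v` over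
`ℤ^n`, and `m'_{v,1},…,m'_{v,n} ∈ M'_v` the dual basis.  For every `y ∈ ℂ` and every
`z ∈ ℂ^n` such that `ψ([m'_{v,i}]) e^{⟨m'_{v,i},z⟩} ≠ 1` for all vertices `v`, all `i` and
all characters `ψ` of `M'_v/ℤ^n`, the weighted Brion formula holds:
`∑_{E ⪯ P} (1+y)^{dim E} ∑_{m ∈ Relint(E) ∩ ℤ^n} e^{⟨m,z⟩}
  = ∑_{v vertex} (e^{⟨v,z⟩}/d_v) ∑_ψ ∏ᵢ (1 + y ψ([m'_{v,i}]) e^{⟨m'_{v,i},z⟩})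
      /(1 - ψ([m'_{v,i}]) e^{⟨m'_{v,i},z⟩})`. -/
theorem stmt9 (n : ℕ) (S : Finset (Fin n → ℤ))
    (P : Set (Fin n → ℝ)) (hP : P = convexHull ℝ (castZ '' ↑S))
    (hfull : (interior P).Nonempty)
    (uV : (Fin n → ℤ) → Fin n → Fin n → ℤ)
    (mV : (Fin n → ℤ) → Fin n → Fin n → ℚ)
    (hprim : ∀ v ∈ S, castZ v ∈ P.extremePoints ℝ →
      ∀ j, Finset.univ.gcd (uV v j) = 1)
    (htan : ∀ v ∈ S, castZ v ∈ P.extremePoints ℝ →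
      ∃ ε > 0, P ∩ Metric.ball (castZ v) ε =
        tanConeN (castZ v) (uV v) ∩ Metric.ball (castZ v) ε)
    (hdual : ∀ v ∈ S, castZ v ∈ P.extremePoints ℝ →
      ∀ i j, ∑ k, mV v i k * (uV v j k : ℚ) = if i = j then 1 else 0)
    (hmem : ∀ v ∈ S, castZ v ∈ P.extremePoints ℝ → ∀ i, mV v i ∈ Mv (uV v))
    (y : ℂ) (z : Fin n → ℂ)
    (hz : ∀ v ∈ S, castZ v ∈ P.extremePoints ℝ →
      ∀ (i : Fin n) (ψ : AddChar (Qv (uV v)) ℂˣ),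
        (ψ (clsOf (uV v) (mV v i)) : ℂ) * Complex.exp (pairCQ (mV v i) z) ≠ 1) :
    ∑ᶠ (E : Set (Fin n → ℝ)) (_ : IsFaceOf P E),
        (1 + y) ^ Module.finrank ℝ (affineSpan ℝ E).direction *
          ∑ᶠ (x : Fin n → ℤ) (_ : castZ x ∈ intrinsicInterior ℝ E),
            Complex.exp (pairCZ x z)
      = ∑ v ∈ S.filter (fun v => castZ v ∈ P.extremePoints ℝ),
          (Complex.exp (pairCZ v z) / (Nat.card (Qv (uV v)) : ℂ)) *
            ∑ᶠ ψ : AddChar (Qv (uV v)) ℂˣ,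
              ∏ i, (1 + y * (ψ (clsOf (uV v) (mV v i)) : ℂ) *
                      Complex.exp (pairCQ (mV v i) z)) /
                   (1 - (ψ (clsOf (uV v) (mV v i)) : ℂ) *
                      Complex.exp (pairCQ (mV v i) z)) := by
  have hcomp : IsCompact P := by
    rw [hP]; exact (S.finite_toSet.image _).isCompact_convexHull ℝ
  have hconv : Convex ℝ P := by rw [hP]; exact convex_convexHull ℝ _
  have hfin := finite_setOf_castZ_mem hcomp.isBounded
  have hΛ : ∀ x, x ∈ hfin.toFinset ↔ castZ x ∈ P := fun x => hfin.mem_toFinset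
  rw [finsum_faces_eq hconv hΛ]
  have hPV := eq_convexHull_extremePoints hP
  set V := S.filter fun v => castZ v ∈ P.extremePoints ℝ
  have hVS : ∀ v ∈ V, v ∈ S ∧ castZ v ∈ P.extremePoints ℝ := fun v => Finset.mem_filter.1
  have hdual' := fun v hv => hdual v (hVS v hv).1 (hVS v hv).2
  set L : Finset (Fin n → ℝ) := (V.offDiag.image fun p => castZ p.1 - castZ p.2) ∪
    V.biUnion fun v => Finset.univ.image fun i => castQ (mV v i)
  have hLcases : ∀ l ∈ L, (∃ v w, v ≠ w ∧ castZ v - castZ w = l) ∨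
      ∃ v ∈ V, ∃ i, castQ (mV v i) = l := by
    intro l hl
    rcases Finset.mem_union.1 hl with h | h
    · obtain ⟨p, hp, rfl⟩ := Finset.mem_image.1 h
      exact Or.inl ⟨_, _, (Finset.mem_offDiag.1 hp).2.2, rfl⟩
    · obtain ⟨v, hv, h⟩ := Finset.mem_biUnion.1 h
      obtain ⟨i, -, rfl⟩ := Finset.mem_image.1 h
      exact Or.inr ⟨v, hv, i, rfl⟩
  obtain ⟨k, hk, hact⟩ := exists_act_stepOp_eq_zero (L := L) hPV
    (fun v hv => htan v (hVS v hv).1 (hVS v hv).2) hdual' y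
    (fun v hv w hw hvw => Finset.mem_union_left _
      (Finset.mem_image.2 ⟨(v, w), Finset.mem_offDiag.2 ⟨hv, hw, hvw⟩, rfl⟩))
    (fun v hv i => Finset.mem_union_right _
      (Finset.mem_biUnion.2 ⟨v, hv, Finset.mem_image_of_mem _ (Finset.mem_univ i)⟩))
  obtain ⟨D, hD, hD0⟩ := exists_ne_zero_act_indicator_eq_zero
    (fun l hl => by
      rcases hLcases l hl with ⟨v, w, hvw, rfl⟩ | ⟨v, hv, i, rfl⟩
      · exact sub_ne_zero.2 fun h => hvw (castZ_injective h)
      · exact (linearIndependent_castQ (hdual' v hv)).ne_zero i)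
    (fun l hl => by
      rcases hLcases l hl with ⟨v, w, hvw, rfl⟩ | ⟨v, hv, i, rfl⟩
      · refine ⟨1, one_pos, ?_⟩
        rw [one_smul]
        exact (intLatR n).sub_mem (castZ_mem_intLatR v) (castZ_mem_intLatR w)
      · exact exists_smul_castQ_mem _) hk hact
  obtain ⟨f, hf, hev⟩ := exists_coeff_eq_indicator (w := polyWeight y P) (Λ := hfin.toFinset)
    (fun x hx => if_neg fun h => hx ((hΛ x).2 h)) z
  rw [← hev]
  refine HasValue.eval_eq (HasValue.sum fun v hv => hasValue_indicator_coneWeight (hdual' v hv)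
    (hmem v (hVS v hv).1 (hVS v hv).2) v y z (hz v (hVS v hv).1 (hVS v hv).2)) hD ?_
  rw [hf, ← Finset.indicator_sum, ← Set.indicator_sub']
  exact hD0
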